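/- arXiv:2405.00584 — 2 statements merged into one kernel-verified Lean document; each statement's English description precedes it below -/
import Mathlib

section
/- Let n ∈ {24, 32, 40} and let C be an extremal Type II Z_8-code of length n with a generator matrix in standard form of type (k_1,k_2,k_3), such that the Z_4-residue code C^{(4)} is extremal (minimum Euclidean weight 16). Let w ∈ (Z/8)^n \ C be a vector all of whose coordinates are 0 or 4, with S_4(w) ⊆ {k_1+k_2+k_3+1, …, n} and |S_4(w)| ≥ 2. Then the Type II Z_8-code C̃ = {v ∈ C : ⟨w,v⟩ = 0} + ⟨w⟩ is extremal (minimum Euclidean weight 32) if and only if no codeword v ∈ C satisfies either of the following: (1) S_3(v) ∪ S_4(v) ∪ S_5(v) ⊆ S_4(w) ⊆ S_2(v) ∪ S_3(v) ∪ S_4(v) ∪ S_5(v) ∪ S_6(v) and wt_E(v mod 4) = 16; (2) |S_4(w) \ S_4(v)| + |S_4(v) \ S_4(w)| = 1 and wt_E(v mod 4) = 0. -/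
open Finset

/-- Inner product of two vectors over `ZMod N`. -/
def innerZ {N n : ℕ} (x y : Fin n → ZMod N) : ZMod N := ∑ i, x i * y i

/-- Euclidean weight of a vector over `ZMod N`. -/
def euclWt {N n : ℕ} (x : Fin n → ZMod N) : ℕ :=
  ∑ i, min ((x i).val ^ 2) ((N - (x i).val) ^ 2)

/-- Number of coordinates of `x` equal to `a`. -/
def cntEq {N n : ℕ} (a : ZMod N) (x : Fin n → ZMod N) : ℕ :=
  (Finset.univ.filter fun j => x j = a).card

/-- A code is self-dual if it equals its dual. -/
def IsSelfDual {N n : ℕ} (C : AddSubgroup (Fin n → ZMod N)) : Prop :=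
  ∀ x, x ∈ C ↔ ∀ y ∈ C, innerZ x y = 0

/-- The subcode `{v ∈ C : ⟨w, v⟩ = 0}`. -/
def evenPart {N n : ℕ} (C : AddSubgroup (Fin n → ZMod N)) (w : Fin n → ZMod N) :
    AddSubgroup (Fin n → ZMod N) where
  carrier := {v | v ∈ C ∧ innerZ w v = 0}
  zero_mem' := ⟨C.zero_mem, by simp [innerZ]⟩
  add_mem' := by
    rintro a b ⟨ha, ha0⟩ ⟨hb, hb0⟩
    refine ⟨C.add_mem ha hb, ?_⟩
    have h : innerZ w (a + b) = innerZ w a + innerZ w b := by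
      simp [innerZ, mul_add, Finset.sum_add_distrib]
    rw [h, ha0, hb0, add_zero]
  neg_mem' := by
    rintro a ⟨ha, ha0⟩
    refine ⟨C.neg_mem ha, ?_⟩
    have h : innerZ w (-a) = - innerZ w a := by
      simp [innerZ]
    rw [h, ha0, neg_zero]

/-- `kv` extended to all of `ℕ` by zero. -/
def extk {m : ℕ} (kv : Fin m → ℕ) : ℕ → ℕ := fun t => if h : t < m then kv ⟨t, h⟩ else 0

/-- Partial sums `k_1 + ⋯ + k_j`. -/
def psum {m : ℕ} (kv : Fin m → ℕ) (j : ℕ) : ℕ := ∑ t ∈ Finset.range j, extk kv t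

/-- `G` is a generator matrix in standard form of type `(k_1, …, k_m)`. -/
def StandardForm {N : ℕ} {m n : ℕ} (kv : Fin m → ℕ)
    (G : Fin (psum kv m) → Fin n → ZMod N) : Prop :=
  psum kv m ≤ n ∧
  ∀ (j : Fin m) (r : Fin (psum kv m)), psum kv (j : ℕ) ≤ (r : ℕ) → (r : ℕ) < psum kv ((j : ℕ) + 1) →
    ∀ c : Fin n,
      (∀ l : Fin m, psum kv (l : ℕ) ≤ (c : ℕ) → (c : ℕ) < psum kv ((l : ℕ) + 1) →
        (l < j → G r c = 0) ∧
        (l = j → G r c = if (r : ℕ) = (c : ℕ) then (2 ^ (j : ℕ) : ZMod N) else 0)) ∧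
      ((psum kv m ≤ (c : ℕ) ∨
        ∃ l : Fin m, j < l ∧ psum kv (l : ℕ) ≤ (c : ℕ) ∧ (c : ℕ) < psum kv ((l : ℕ) + 1)) →
        ∃ a : ZMod N, G r c = 2 ^ (j : ℕ) * a)

/-- The minimum Euclidean weight over nonzero codewords equals `d`. -/
def minEuclWtIs {N n : ℕ} (C : AddSubgroup (Fin n → ZMod N)) (d : ℕ) : Prop :=
  (∀ x ∈ C, x ≠ 0 → d ≤ euclWt x) ∧ ∃ x ∈ C, x ≠ 0 ∧ euclWt x = d

/-- Coordinatewise reduction modulo 4. -/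
def res4 {n : ℕ} : (Fin n → ZMod 8) →+ (Fin n → ZMod 4) where
  toFun := fun x i => ZMod.castHom (by norm_num : (4 : ℕ) ∣ 8) (ZMod 4) (x i)
  map_zero' := by ext i; simp
  map_add' := by intro a b; ext i; exact map_add (ZMod.castHom (by norm_num) _) _ _

/-- Coordinatewise reduction modulo 2. -/
def res2 {n : ℕ} : (Fin n → ZMod 8) →+ (Fin n → ZMod 2) where
  toFun := fun x i => ZMod.castHom (by norm_num : (2 : ℕ) ∣ 8) (ZMod 2) (x i)
  map_zero' := by ext i; simp
  map_add' := by intro a b; ext i; exact map_add (ZMod.castHom (by norm_num) _) _ _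

/-- Hamming weight of a binary vector. -/
def hammingWt {n : ℕ} (y : Fin n → ZMod 2) : ℕ :=
  (Finset.univ.filter fun i => y i ≠ 0).card

/-- Equivalence of codes: a permutation of coordinates combined with sign changes. -/
def codeEquiv {N n : ℕ} (C C' : AddSubgroup (Fin n → ZMod N)) : Prop :=
  ∃ (σ : Equiv.Perm (Fin n)) (ε : Fin n → ZMod N),
    (∀ i, ε i = 1 ∨ ε i = -1) ∧
    ∀ y, y ∈ C' ↔ ∃ x ∈ C, y = fun i => ε i * x (σ i)

open scoped MatrixGroups in
/-- There is no level one modular form of weight `12`, `16` or `20` with `q`-expansion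
`1 + O(q³)`. -/
theorem ModularForm.not_sparse_qExpansion {i : ℕ} (hi : i ≤ 2)
    (f : ModularForm 𝒮ℒ ((4 * (i + 3) : ℕ) : ℤ))
    (h0 : (UpperHalfPlane.qExpansion 1 f).coeff 0 = 1)
    (h1 : (UpperHalfPlane.qExpansion 1 f).coeff 1 = 0)
    (h2 : (UpperHalfPlane.qExpansion 1 f).coeff 2 = 0) : False := by
  have hs := one_mem_strictPeriods_SL
  set P := UpperHalfPlane.qExpansion 1 ModularForm.E₄ with hP
  set Q := UpperHalfPlane.qExpansion 1 ModularForm.E₆ with hQ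
  have hP0 : P.coeff 0 = 1 := EisensteinSeries.E_qExpansion_coeff_zero _ ⟨2, rfl⟩
  have hQ0 : Q.coeff 0 = 1 := EisensteinSeries.E_qExpansion_coeff_zero _ ⟨3, rfl⟩
  have hP1 : P.coeff 1 = 240 := ModularForm.E₄_qExpansion_coeff_one
  have hQ1 : Q.coeff 1 = -504 := ModularForm.E₆_qExpansion_coeff_one
  have hb4 : bernoulli 4 = -1 / 30 := by decide +kernel
  have hb6 : bernoulli 6 = 1 / 42 := by decide +kernel
  have hs3 : ArithmeticFunction.sigma 3 2 = 9 := by decide +kernel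
  have hs5 : ArithmeticFunction.sigma 5 2 = 33 := by decide +kernel
  have hP2 : P.coeff 2 = 2160 := by
    rw [hP, EisensteinSeries.E_qExpansion_coeff _ ⟨2, rfl⟩]
    norm_num [hb4, hs3]
  have hQ2 : Q.coeff 2 = -16632 := by
    rw [hQ, EisensteinSeries.E_qExpansion_coeff _ ⟨3, rfl⟩]
    norm_num [hb6, hs5]
  let A : ModularForm 𝒮ℒ ((4 * (i + 3) : ℕ) : ℤ) :=
    ModularForm.mcast (by push_cast; ring) (ModularForm.E₄.pow (i + 3))
  let B : ModularForm 𝒮ℒ ((4 * (i + 3) : ℕ) : ℤ) :=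
    ModularForm.mcast (by push_cast; ring) ((ModularForm.E₄.pow i).mul (ModularForm.E₆.pow 2))
  have hA : UpperHalfPlane.qExpansion 1 A = P ^ (i + 3) :=
    ModularForm.qExpansion_pow one_pos hs _ _
  have hB : UpperHalfPlane.qExpansion 1 B = P ^ i * Q ^ 2 := by
    refine (ModularForm.qExpansion_mul one_pos hs _ _).trans ?_
    rw [ModularForm.qExpansion_pow one_pos hs, ModularForm.qExpansion_pow one_pos hs]
  have key : ∀ a b : ℂ,
      (∀ m < 2, (UpperHalfPlane.qExpansion 1 f - (a • P ^ (i + 3) + b • (P ^ i * Q ^ 2))).coeff m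
        = 0) →
      UpperHalfPlane.qExpansion 1 f - (a • P ^ (i + 3) + b • (P ^ i * Q ^ 2)) = 0 := by
    intro a b hab
    let H : ModularForm 𝒮ℒ ((4 * (i + 3) : ℕ) : ℤ) := f - (a • A + b • B)
    have hq : UpperHalfPlane.qExpansion 1 H =
        UpperHalfPlane.qExpansion 1 f - (a • P ^ (i + 3) + b • (P ^ i * Q ^ 2)) := by
      refine (ModularForm.qExpansion_sub one_pos hs f (a • A + b • B)).trans ?_
      congr 1
      refine (ModularForm.qExpansion_add one_pos hs (a • A) (b • B)).trans ?_
      rw [← hA, ← hB]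
      congr 1
      · exact ModularForm.qExpansion_smul one_pos hs a A
      · exact ModularForm.qExpansion_smul one_pos hs b B
    have hz : H = 0 := by
      apply ModularForm.sturm_bound_levelOne_nat
      rw [hq]
      have : ((2 : ℕ) : ℕ∞) ≤ (UpperHalfPlane.qExpansion 1 f -
          (a • P ^ (i + 3) + b • (P ^ i * Q ^ 2))).order :=
        PowerSeries.le_order _ _ fun m hm ↦ hab m (by exact_mod_cast hm)
      refine lt_of_lt_of_le ?_ this
      norm_cast
      omega
    rw [← hq, hz]
    exact UpperHalfPlane.qExpansion_zero 1
  have finish : ∀ a b : ℂ,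
      (∀ m < 2, (UpperHalfPlane.qExpansion 1 f - (a • P ^ (i + 3) + b • (P ^ i * Q ^ 2))).coeff m
        = 0) →
      (a • P ^ (i + 3) + b • (P ^ i * Q ^ 2)).coeff 2 = 0 := by
    intro a b hab
    have := congrArg (PowerSeries.coeff 2) (key a b hab)
    rwa [map_sub, h2, map_zero, zero_sub, neg_eq_zero] at this
  rw [PowerSeries.coeff_zero_eq_constantCoeff] at hP0 hQ0 h0
  interval_cases i
  · have := finish (7 / 12) (5 / 12) (by
      intro m hm
      interval_cases m <;>
      norm_num [pow_succ, PowerSeries.coeff_mul, Finset.Nat.antidiagonal_succ, hP0, hQ0, hP1, hQ1,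
        h0, h1])
    norm_num [pow_succ, PowerSeries.coeff_mul, Finset.Nat.antidiagonal_succ, hP0, hQ0, hP1, hQ1,
      hP2, hQ2] at this
  · have := finish (4 / 9) (5 / 9) (by
      intro m hm
      interval_cases m <;>
      norm_num [pow_succ, PowerSeries.coeff_mul, Finset.Nat.antidiagonal_succ, hP0, hQ0, hP1, hQ1,
        h0, h1])
    norm_num [pow_succ, PowerSeries.coeff_mul, Finset.Nat.antidiagonal_succ, hP0, hQ0, hP1, hQ1,
      hP2, hQ2] at this
  · have := finish (11 / 36) (25 / 36) (by
      intro m hm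
      interval_cases m <;>
      norm_num [pow_succ, PowerSeries.coeff_mul, Finset.Nat.antidiagonal_succ, hP0, hQ0, hP1, hQ1,
        h0, h1])
    norm_num [pow_succ, PowerSeries.coeff_mul, Finset.Nat.antidiagonal_succ, hP0, hQ0, hP1, hQ1,
      hP2, hQ2] at this

open Complex in
theorem Complex.im_neg_one_div_pos {τ : ℂ} (hτ : 0 < τ.im) : 0 < (-1 / τ).im := by
  have hτ0 : τ ≠ 0 := by rintro rfl; simp at hτ
  rw [neg_div, one_div, neg_im, inv_im, neg_div, neg_neg]
  exact div_pos hτ (normSq_pos.mpr hτ0)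

theorem Complex.norm_pow_sub_one_le {z : ℂ} {b : ℝ} (hb : 1 ≤ b) (hz : ‖z‖ ≤ b) (n : ℕ) :
    ‖z ^ n - 1‖ ≤ n * b ^ n * ‖z - 1‖ := by
  rw [← mul_geom_sum, norm_mul, mul_comm]
  gcongr
  refine (norm_sum_le _ _).trans ((Finset.sum_le_card_nsmul _ _ (b ^ n) fun j hj ↦ ?_).trans_eq ?_)
  · rw [norm_pow]
    exact (pow_le_pow_left₀ (norm_nonneg _) hz j).trans
      (pow_le_pow_right₀ hb (Finset.mem_range.mp hj).le)
  · simp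

open Complex in
/-- The theta series of the coset `a + 8ℤ` of the lattice `8ℤ`, scaled by `1 / √8`. -/
noncomputable def cosetTheta (a : ZMod 8) (τ : ℂ) : ℂ :=
  ∑' k : ℤ, cexp (Real.pi * I * (8 * k + a.val) ^ 2 / 8 * τ)

namespace cosetTheta

open Complex Real

theorem term_eq (a : ZMod 8) (τ : ℂ) (k : ℤ) :
    cexp (π * I * (8 * k + a.val) ^ 2 / 8 * τ) =
      cexp (π * I * a.val ^ 2 / 8 * τ) * jacobiTheta₂_term k (a.val * τ) (8 * τ) := by
  rw [jacobiTheta₂_term, ← Complex.exp_add]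
  congr 1
  ring

theorem summable (a : ZMod 8) {τ : ℂ} (hτ : 0 < τ.im) :
    Summable fun k : ℤ ↦ cexp (π * I * (8 * k + a.val) ^ 2 / 8 * τ) := by
  simp_rw [term_eq]
  exact ((summable_jacobiTheta₂_term_iff _ _).mpr (by simpa using hτ)).mul_left _

theorem eq_jacobiTheta₂ (a : ZMod 8) (τ : ℂ) :
    cosetTheta a τ = cexp (π * I * a.val ^ 2 / 8 * τ) * jacobiTheta₂ (a.val * τ) (8 * τ) := by
  simp_rw [cosetTheta, term_eq, tsum_mul_left, jacobiTheta₂]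

theorem differentiableAt (a : ZMod 8) {τ : ℂ} (hτ : 0 < τ.im) :
    DifferentiableAt ℂ (cosetTheta a) τ := by
  have h1 : DifferentiableAt ℂ (fun p : ℂ × ℂ ↦ jacobiTheta₂ p.1 p.2) (a.val * τ, 8 * τ) :=
    (hasFDerivAt_jacobiTheta₂ _ (by simpa using hτ)).differentiableAt
  have h2 : DifferentiableAt ℂ (fun τ : ℂ ↦ ((a.val : ℂ) * τ, 8 * τ)) τ := by fun_prop
  have h3 : DifferentiableAt ℂ (fun τ : ℂ ↦ jacobiTheta₂ (a.val * τ) (8 * τ)) τ := h1.comp (f := fun τ : ℂ ↦ ((a.val : ℂ) * τ, 8 * τ)) τ h2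
  rw [funext (eq_jacobiTheta₂ a)]
  fun_prop

theorem add_one (a : ZMod 8) (τ : ℂ) :
    cosetTheta a (τ + 1) = cexp (π * I * a.val ^ 2 / 8) * cosetTheta a τ := by
  rw [cosetTheta, cosetTheta, ← tsum_mul_left]
  refine tsum_congr fun k ↦ ?_
  rw [← Complex.exp_add, Complex.exp_eq_exp_iff_exists_int]
  refine ⟨4 * k ^ 2 + k * a.val, ?_⟩
  push_cast
  ring

theorem functional_equation (a : ZMod 8) {τ : ℂ} (hτ : 0 < τ.im) :
    cosetTheta a τ =
      1 / (-I * (8 * τ)) ^ (1 / 2 : ℂ) * ∑ b, ZMod.stdAddChar (a * b) * cosetTheta b (-1 / τ) := by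
  have hτ0 : τ ≠ 0 := by rintro rfl; simp at hτ
  have hτ' : 0 < (-1 / τ).im := im_neg_one_div_pos hτ
  rw [eq_jacobiTheta₂, jacobiTheta₂_functional_equation]
  have hz : (a.val * τ) / (8 * τ) = a.val / 8 := by field_simp
  have hexp : cexp (π * I * a.val ^ 2 / 8 * τ) * cexp (-π * I * (a.val * τ) ^ 2 / (8 * τ)) = 1 := by
    rw [← Complex.exp_add, ← Complex.exp_zero]
    congr 1
    field_simp
    ring
  rw [hz]
  calc _ = 1 / (-I * (8 * τ)) ^ (1 / 2 : ℂ) * jacobiTheta₂ (a.val / 8) (-1 / (8 * τ)) *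
      (cexp (π * I * a.val ^ 2 / 8 * τ) * cexp (-π * I * (a.val * τ) ^ 2 / (8 * τ))) := by ring
    _ = _ := by
      rw [hexp, mul_one]
      congr 1
      have him : 0 < (-1 / (8 * τ)).im := by
        have : -1 / (8 * τ) = (8 : ℝ)⁻¹ * (-1 / τ) := by push_cast; field_simp
        rw [this, im_ofReal_mul]
        positivity
      have hs := (summable_jacobiTheta₂_term_iff (a.val / 8) (-1 / (8 * τ))).mpr him
      let e : ZMod 8 × ℤ ≃ ℤ := ((Int.divModEquiv 8).trans (Equiv.prodComm ℤ (ZMod 8))).symm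
      have he : ∀ p, e p = p.2 * 8 + p.1.val := fun p ↦ rfl
      have hs' : Summable fun p ↦ jacobiTheta₂_term (e p) (a.val / 8) (-1 / (8 * τ)) :=
        e.summable_iff.mpr hs
      rw [jacobiTheta₂, ← e.tsum_eq, hs'.tsum_prod, tsum_fintype]
      refine Finset.sum_congr rfl fun b _ ↦ ?_
      rw [cosetTheta, ← tsum_mul_left]
      refine tsum_congr fun k ↦ ?_
      have hab : a * b = ((a.val * b.val : ℤ) : ZMod 8) := by simp
      rw [hab, ZMod.stdAddChar_coe, ← Complex.exp_add, he, jacobiTheta₂_term,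
        Complex.exp_eq_exp_iff_exists_int]
      refine ⟨k * a.val, ?_⟩
      push_cast
      field_simp
      ring

theorem norm_term (a : ZMod 8) (τ : ℂ) (k : ℤ) :
    ‖cexp (π * I * (8 * k + a.val) ^ 2 / 8 * τ)‖ =
      Real.exp (-π * (8 * k + a.val) ^ 2 / 8 * τ.im) := by
  have : π * I * (8 * k + a.val) ^ 2 / 8 * τ =
      ((π * (8 * k + a.val) ^ 2 / 8 : ℝ) : ℂ) * (I * τ) := by push_cast; ring
  rw [Complex.norm_exp, this, re_ofReal_mul, I_mul_re]
  congr 1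
  ring

theorem summable_exp (a : ZMod 8) :
    Summable fun k : ℤ ↦ Real.exp (-π * (8 * k + a.val) ^ 2 / 8) := by
  have := (summable a (τ := I) (by simp)).norm
  simp_rw [norm_term] at this
  simpa using this

theorem norm_term_le {a : ZMod 8} {τ : ℂ} (hτ : 1 ≤ τ.im) {m : ℝ} {k : ℤ}
    (h : m ≤ (8 * k + a.val : ℝ) ^ 2) :
    ‖cexp (π * I * (8 * k + a.val) ^ 2 / 8 * τ)‖ ≤
      Real.exp (-π * m / 8 * (τ.im - 1)) * Real.exp (-π * (8 * k + a.val) ^ 2 / 8) := by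
  rw [norm_term, ← Real.exp_add, Real.exp_le_exp]
  have : 0 ≤ π * (τ.im - 1) * ((8 * k + a.val : ℝ) ^ 2 - m) :=
    mul_nonneg (mul_nonneg pi_pos.le (by linarith)) (by linarith)
  linarith

theorem min_sq_le (a : ZMod 8) (k : ℤ) :
    ((min (a.val ^ 2) ((8 - a.val) ^ 2) : ℕ) : ℝ) ≤ (8 * k + a.val : ℝ) ^ 2 := by
  have ha : a.val < 8 := a.val_lt
  have : ((min (a.val ^ 2) ((8 - a.val) ^ 2) : ℕ) : ℤ) ≤ (8 * k + a.val) ^ 2 := by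
    rcases le_or_gt 0 k with hk | hk
    · refine (Int.ofNat_le.mpr (min_le_left _ _)).trans ?_
      push_cast
      exact pow_le_pow_left₀ (by positivity) (by omega) 2
    · refine (Int.ofNat_le.mpr (min_le_right _ _)).trans ?_
      push_cast [ha.le]
      rw [← neg_sq (8 * k + _)]
      exact pow_le_pow_left₀ (by omega) (by omega) 2
  exact_mod_cast this

/-- A uniform bound for the theta series of the cosets `a + 8ℤ` on `1 ≤ im τ`. -/
noncomputable def bound : ℝ := 1 + ∑ a : ZMod 8, ∑' k : ℤ, Real.exp (-π * (8 * k + a.val) ^ 2 / 8)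

theorem tsum_exp_le_bound (a : ZMod 8) :
    ∑' k : ℤ, Real.exp (-π * (8 * k + a.val) ^ 2 / 8) ≤ bound := by
  have := Finset.single_le_sum (f := fun a : ZMod 8 ↦
    ∑' k : ℤ, Real.exp (-π * (8 * k + a.val) ^ 2 / 8))
    (fun a _ ↦ tsum_nonneg fun k ↦ (Real.exp_pos _).le) (Finset.mem_univ a)
  rw [bound]
  linarith

theorem one_le_bound : 1 ≤ bound := by
  rw [bound, le_add_iff_nonneg_right]
  exact Finset.sum_nonneg fun a _ ↦ tsum_nonneg fun k ↦ (Real.exp_pos _).le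

theorem norm_le (a : ZMod 8) {τ : ℂ} (hτ : 1 ≤ τ.im) :
    ‖cosetTheta a τ‖ ≤
      bound * Real.exp (-π * (min (a.val ^ 2) ((8 - a.val) ^ 2) : ℕ) / 8 * (τ.im - 1)) := by
  refine (norm_tsum_le_tsum_norm (summable a (by linarith)).norm).trans ?_
  refine ((summable a (by linarith)).norm.tsum_le_tsum
    (fun k ↦ norm_term_le hτ (min_sq_le a k)) ((summable_exp a).mul_left _)).trans ?_
  rw [tsum_mul_left, mul_comm]
  gcongr
  exact tsum_exp_le_bound a

theorem norm_zero_sub_one_le {τ : ℂ} (hτ : 1 ≤ τ.im) :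
    ‖cosetTheta 0 τ - 1‖ ≤ bound * Real.exp (-8 * π * (τ.im - 1)) := by
  have hs := summable 0 (show 0 < τ.im by linarith)
  rw [cosetTheta, hs.tsum_eq_add_tsum_ite 0]
  have h0 : cexp (π * I * (8 * (0 : ℤ) + (0 : ZMod 8).val) ^ 2 / 8 * τ) = 1 := by simp
  rw [h0, add_sub_cancel_left]
  have hle : ∀ k : ℤ, ‖if k = 0 then 0 else
      cexp (π * I * (8 * k + (0 : ZMod 8).val) ^ 2 / 8 * τ)‖ ≤
      Real.exp (-8 * π * (τ.im - 1)) * Real.exp (-π * (8 * k + (0 : ZMod 8).val) ^ 2 / 8) := by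
    intro k
    split_ifs with hk
    · rw [norm_zero]
      positivity
    · have hk' : (1 : ℝ) ≤ (k : ℝ) ^ 2 := by
        have : 0 < k ^ 2 := by positivity
        exact_mod_cast this
      refine (norm_term_le hτ (m := 64) ?_).trans_eq ?_
      · rw [ZMod.val_zero]
        push_cast
        linarith
      · congr 2
        ring
  have hs2 := (summable_exp 0).mul_left (Real.exp (-8 * π * (τ.im - 1)))
  refine (tsum_of_norm_bounded hs2.hasSum hle).trans ?_
  rw [tsum_mul_left, mul_comm]
  gcongr
  exact tsum_exp_le_bound 0

end cosetTheta

theorem innerZ_add_left {N n : ℕ} (x y z : Fin n → ZMod N) :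
    innerZ (x + y) z = innerZ x z + innerZ y z := by
  simp [innerZ, add_mul, Finset.sum_add_distrib]

theorem innerZ_comm {N n : ℕ} (x y : Fin n → ZMod N) : innerZ x y = innerZ y x := by
  simp [innerZ, mul_comm]

theorem innerZ_add_right {N n : ℕ} (x y z : Fin n → ZMod N) :
    innerZ x (y + z) = innerZ x y + innerZ x z := by
  simp [innerZ, mul_add, Finset.sum_add_distrib]

namespace IsSelfDual

variable {N n : ℕ} [NeZero N] {D : AddSubgroup (Fin n → ZMod N)} [Fintype D]

theorem sum_stdAddChar (hD : IsSelfDual D) (v : Fin n → ZMod N) [Decidable (v ∈ D)] :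
    ∑ c : D, ZMod.stdAddChar (innerZ c.1 v) = if v ∈ D then (Fintype.card D : ℂ) else 0 := by
  let g : D →+ ZMod N :=
    { toFun := fun c ↦ innerZ c.1 v
      map_zero' := by simp [innerZ]
      map_add' := fun c d ↦ innerZ_add_left c.1 d.1 v }
  have h := AddChar.sum_eq_ite ((ZMod.stdAddChar (N := N)).compAddMonoidHom g)
  have hv : (ZMod.stdAddChar (N := N)).compAddMonoidHom g = 0 ↔ v ∈ D := by
    rw [hD v, AddChar.ext_iff]
    constructor
    · intro hg y hy
      apply ZMod.injective_stdAddChar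
      rw [innerZ_comm, AddChar.map_zero_eq_one]
      exact hg ⟨y, hy⟩
    · intro hv c
      change ZMod.stdAddChar (innerZ c.1 v) = 1
      rw [innerZ_comm, hv c.1 c.2, AddChar.map_zero_eq_one]
  refine h.trans ?_
  simp only [hv]

/-- The MacWilliams identity for complete weight enumerators of self-dual codes. -/
theorem macWilliams (hD : IsSelfDual D) (ψ : ZMod N → ℂ) :
    ∑ c : D, ∏ i, ∑ b, ZMod.stdAddChar (c.1 i * b) * ψ b =
      Fintype.card D * ∑ c : D, ∏ i, ψ (c.1 i) := by
  classical
  have hprod : ∀ c : D, ∏ i, ∑ b, ZMod.stdAddChar (c.1 i * b) * ψ b =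
      ∑ v : Fin n → ZMod N, ZMod.stdAddChar (innerZ c.1 v) * ∏ i, ψ (v i) := by
    intro c
    rw [Finset.prod_univ_sum, Fintype.piFinset_univ]
    refine Finset.sum_congr rfl fun v _ ↦ ?_
    rw [Finset.prod_mul_distrib]
    congr 1
    exact (map_prod (ZMod.stdAddChar (N := N)).toMonoidHom
      (fun i ↦ Multiplicative.ofAdd (c.1 i * v i)) Finset.univ).symm
  simp_rw [hprod]
  rw [Finset.sum_comm]
  simp_rw [← Finset.sum_mul, hD.sum_stdAddChar, ite_mul, zero_mul]
  rw [← Finset.sum_filter, Finset.mul_sum]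
  exact Finset.sum_subtype (p := (· ∈ D)) (f := fun v ↦ (Fintype.card D : ℂ) * ∏ i, ψ (v i))
    (Finset.univ.filter (· ∈ D)) (by simp)

theorem card_mul_card (hD : IsSelfDual D) : Fintype.card D * Fintype.card D = N ^ n := by
  classical
  have h := hD.macWilliams fun _ ↦ 1
  have hchar : ∀ a : ZMod N, ∑ b, ZMod.stdAddChar (a * b) = if a = 0 then (N : ℂ) else 0 := by
    intro a
    simp_rw [mul_comm a]
    rw [AddChar.sum_mulShift a (ZMod.isPrimitive_stdAddChar N), ZMod.card]
    push_cast
    rfl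
  simp only [mul_one, hchar, Finset.prod_const_one, Finset.sum_const, Finset.card_univ,
    nsmul_eq_mul] at h
  rw [Finset.sum_eq_single (0 : D)] at h
  · simp only [ZeroMemClass.coe_zero, Pi.zero_apply, if_true, Finset.prod_const, Finset.card_univ,
      Fintype.card_fin] at h
    exact_mod_cast h.symm
  · intro c _ hc
    obtain ⟨i, hi⟩ : ∃ i, c.1 i ≠ 0 := by
      by_contra! hall
      exact hc (Subtype.ext (funext hall))
    exact Finset.prod_eq_zero (Finset.mem_univ i) (if_neg hi)
  · simp

end IsSelfDual

theorem euclWt_modEq {n : ℕ} (x : Fin n → ZMod 8) : euclWt x ≡ ∑ i, (x i).val ^ 2 [MOD 16] := by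
  have h : ∀ a : ZMod 8, min (a.val ^ 2) ((8 - a.val) ^ 2) ≡ a.val ^ 2 [MOD 16] := by decide
  exact Nat.ModEq.sum fun i _ ↦ h (x i)

open Complex in
/-- The theta series of the lattice obtained from a code over `ZMod 8` by construction A. -/
noncomputable def codeTheta {n : ℕ} (D : AddSubgroup (Fin n → ZMod 8)) [Fintype D] (τ : ℂ) : ℂ :=
  ∑ c : D, ∏ i, cosetTheta (c.1 i) τ

namespace codeTheta

open Complex Real

variable {n : ℕ} {D : AddSubgroup (Fin n → ZMod 8)} [Fintype D]

theorem differentiableAt {τ : ℂ} (hτ : 0 < τ.im) : DifferentiableAt ℂ (codeTheta D) τ := by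
  have h : ∀ a, DifferentiableAt ℂ (cosetTheta a) τ := fun a ↦ cosetTheta.differentiableAt a hτ
  unfold codeTheta
  fun_prop

theorem add_one (h : ∀ c ∈ D, 16 ∣ euclWt c) (τ : ℂ) : codeTheta D (τ + 1) = codeTheta D τ := by
  refine Finset.sum_congr rfl fun c _ ↦ ?_
  simp_rw [cosetTheta.add_one, Finset.prod_mul_distrib, ← Complex.exp_sum]
  obtain ⟨t, ht⟩ := ((euclWt_modEq c.1).dvd_iff (dvd_refl 16)).mp (h c.1 c.2)
  have ht' : ∑ i, ((c.1 i).val : ℂ) ^ 2 = 16 * t := by exact_mod_cast ht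
  rw [← Finset.sum_div, ← Finset.mul_sum, ht', show π * I * (16 * t) / 8 = t * (2 * π * I) by ring,
    Complex.exp_nat_mul_two_pi_mul_I, one_mul]

theorem neg_one_div {m : ℕ} (hn : n = 8 * m) (hD : IsSelfDual D) {τ : ℂ} (hτ : 0 < τ.im) :
    codeTheta D (-1 / τ) = τ ^ (4 * m) * codeTheta D τ := by
  have hτ0 : τ ≠ 0 := by rintro rfl; simp at hτ
  have hτ' : 0 < (-1 / τ).im := im_neg_one_div_pos hτ
  have hinv : -1 / (-1 / τ) = τ := by field_simp
  have hcard : Fintype.card D = 8 ^ (4 * m) := by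
    have hsplit : 8 ^ n = 8 ^ (4 * m) * 8 ^ (4 * m) := by
      rw [← pow_add]
      congr 1
      omega
    exact Nat.mul_self_inj.mp (hD.card_mul_card.trans hsplit)
  have hpow : ((-I * (8 * (-1 / τ))) ^ (1 / 2 : ℂ)) ^ n = (8 / τ) ^ (4 * m) := by
    have h2 : ((-I * (8 * (-1 / τ))) ^ (1 / 2 : ℂ)) ^ 2 = -I * (8 * (-1 / τ)) := by
      rw [one_div]
      exact Complex.cpow_ofNat_inv_pow _ 2
    rw [hn, show 8 * m = 2 * (4 * m) by ring, pow_mul, h2,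
      show -I * (8 * (-1 / τ)) = I * (8 / τ) by ring, mul_pow, pow_mul I, I_pow_four, one_pow,
      one_mul]
  calc codeTheta D (-1 / τ)
      = ∑ c : D, ∏ i, (1 / (-I * (8 * (-1 / τ))) ^ (1 / 2 : ℂ) *
          ∑ b, ZMod.stdAddChar (c.1 i * b) * cosetTheta b τ) := by
        refine Finset.sum_congr rfl fun c _ ↦ Finset.prod_congr rfl fun i _ ↦ ?_
        rw [cosetTheta.functional_equation _ hτ', hinv]
    _ = _ := by
        simp_rw [Finset.prod_mul_distrib, ← Finset.mul_sum, hD.macWilliams, Finset.prod_const,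
          Finset.card_univ, Fintype.card_fin, div_pow, hpow, hcard, one_pow, codeTheta]
        push_cast
        rw [div_pow]
        field_simp

theorem norm_prod_le (c : Fin n → ZMod 8) {τ : ℂ} (hτ : 1 ≤ τ.im) :
    ‖∏ i, cosetTheta (c i) τ‖ ≤
      cosetTheta.bound ^ n * Real.exp (-π * euclWt c / 8 * (τ.im - 1)) := by
  rw [norm_prod]
  refine (Finset.prod_le_prod (fun i _ ↦ norm_nonneg _)
    fun i _ ↦ cosetTheta.norm_le (c i) hτ).trans_eq ?_
  rw [Finset.prod_mul_distrib, Finset.prod_const, Finset.card_univ, Fintype.card_fin,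
    ← Real.exp_sum, ← Finset.sum_mul, ← Finset.sum_div, ← Finset.mul_sum, euclWt]
  push_cast
  rfl

theorem norm_sub_one_le (h : ∀ c ∈ D, c ≠ 0 → 48 ≤ euclWt c) :
    ∃ K, ∀ τ : ℂ, 1 ≤ τ.im → ‖codeTheta D τ - 1‖ ≤ K * Real.exp (-6 * π * (τ.im - 1)) := by
  classical
  set b := cosetTheta.bound with hb
  have hb1 : 1 ≤ b := cosetTheta.one_le_bound
  refine ⟨n * b ^ n * b + ∑ c : D, b ^ n, fun τ hτ ↦ ?_⟩
  rw [codeTheta, ← Finset.add_sum_erase _ _ (Finset.mem_univ (0 : D)), add_sub_right_comm,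
    add_mul]
  refine (norm_add_le _ _).trans (add_le_add ?_ ?_)
  · simp only [ZeroMemClass.coe_zero, Pi.zero_apply, Finset.prod_const, Finset.card_univ,
      Fintype.card_fin]
    have hz : ‖cosetTheta 0 τ‖ ≤ b := by simpa using cosetTheta.norm_le 0 hτ
    refine (norm_pow_sub_one_le hb1 hz n).trans ?_
    rw [mul_assoc _ b]
    gcongr
    refine (cosetTheta.norm_zero_sub_one_le hτ).trans ?_
    gcongr
    nlinarith [pi_pos]
  · refine (norm_sum_le _ _).trans ?_
    rw [Finset.sum_mul]
    refine (Finset.sum_le_sum fun c hc ↦ ?_).trans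
      (Finset.sum_le_univ_sum_of_nonneg fun c ↦ by positivity)
    refine (norm_prod_le c.1 hτ).trans ?_
    have hc' : (48 : ℝ) ≤ euclWt c.1 := by
      exact_mod_cast h c.1 c.2 (by simpa using Finset.ne_of_mem_erase hc)
    gcongr
    nlinarith [pi_pos, mul_nonneg (mul_nonneg pi_pos.le (sub_nonneg.mpr hτ)) (sub_nonneg.mpr hc')]

end codeTheta

section QExpansion

open Complex Real Filter Topology Function
open UpperHalfPlane hiding I
open scoped MatrixGroups Manifold

theorem UpperHalfPlane.qExpansion_coeff_eq_zero_of_norm_le {g : ℍ → ℂ}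
    (hper : Periodic (g ∘ ofComplex) 1) (hhol : MDiff g) (hbdd : IsBoundedAtImInfty g)
    {K d : ℝ} (hg : ∀ τ : ℍ, 1 ≤ τ.im → ‖g τ‖ ≤ K * Real.exp (-2 * π * d * τ.im))
    {j : ℕ} (hj : j < d) : (qExpansion 1 g).coeff j = 0 := by
  have hlim : Tendsto (fun t : ℝ ↦ K * Real.exp (-(2 * π * (d - j) * t))) atTop (𝓝 0) := by
    rw [← mul_zero K]
    refine (Real.tendsto_exp_neg_atTop_nhds_zero.comp ?_).const_mul K
    exact tendsto_id.const_mul_atTop (by have := pi_pos; have := sub_pos.mpr hj; positivity)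
  refine norm_le_zero_iff.mp (ge_of_tendsto hlim ?_)
  filter_upwards [eventually_ge_atTop 1] with t ht
  have ht0 : 0 < t := by linarith
  rw [qExpansion_coeff_eq_intervalIntegral one_pos (by exact_mod_cast hper) hhol hbdd j ht0]
  have hbound := intervalIntegral.norm_integral_le_of_norm_le_const (a := 0) (b := 1)
    (f := fun u : ℝ ↦ 1 / Periodic.qParam 1 (u + t * I) ^ j * g ⟨u + t * I, by simpa using ht0⟩)
    (C := K * Real.exp (-(2 * π * (d - j) * t))) fun u _ ↦ by
      have him : (⟨u + t * I, by simpa using ht0⟩ : ℍ).im = t := by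
        change (u + t * I : ℂ).im = t
        simp
      have h1 := hg ⟨u + t * I, by simpa using ht0⟩ (him ▸ ht)
      rw [him] at h1
      rw [norm_mul, norm_div, norm_pow, Periodic.norm_qParam, norm_one, one_div, ← Real.exp_nat_mul,
        ← Real.exp_neg]
      refine (mul_le_mul_of_nonneg_left h1 (Real.exp_pos _).le).trans_eq ?_
      rw [mul_left_comm, ← Real.exp_add]
      congr 2
      simp
      ring
  simpa using hbound

end QExpansion

namespace codeTheta

open Complex Real
open UpperHalfPlane hiding I
open scoped MatrixGroups Manifold ModularForm

variable {n m : ℕ} {D : AddSubgroup (Fin n → ZMod 8)} [Fintype D]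

theorem slash_S (hn : n = 8 * m) (hD : IsSelfDual D) :
    (fun τ : ℍ ↦ codeTheta D τ) ∣[((4 * m : ℕ) : ℤ)] ModularGroup.S = fun τ : ℍ ↦ codeTheta D τ := by
  ext τ
  have h := neg_one_div hn hD τ.im_pos
  suffices codeTheta D (-(τ : ℂ)⁻¹) * ((τ : ℂ) ^ (4 * m))⁻¹ = codeTheta D τ by
    rw [ModularForm.SL_slash_apply, UpperHalfPlane.modular_S_smul, zpow_neg, zpow_natCast]
    simpa [ModularGroup.denom_apply, ModularGroup.coe_S]
  rw [← one_div, ← neg_div, h]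
  field_simp [τ.ne_zero]

theorem slash_T (h : ∀ c ∈ D, 16 ∣ euclWt c) (k : ℤ) :
    (fun τ : ℍ ↦ codeTheta D τ) ∣[k] ModularGroup.T = fun τ : ℍ ↦ codeTheta D τ := by
  ext τ
  rw [ModularForm.SL_slash_apply, UpperHalfPlane.modular_T_smul]
  simp [ModularGroup.denom_apply, ModularGroup.coe_T, add_comm, add_one h]

theorem norm_sub_one_le_exp_im (h : ∀ c ∈ D, c ≠ 0 → 48 ≤ euclWt c) :
    ∃ K, ∀ τ : ℂ, 1 ≤ τ.im → ‖codeTheta D τ - 1‖ ≤ K * Real.exp (-2 * π * 3 * τ.im) := by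
  obtain ⟨K, hK⟩ := norm_sub_one_le h
  refine ⟨K * Real.exp (6 * π), fun τ hτ ↦ (hK τ hτ).trans_eq ?_⟩
  rw [mul_assoc K, ← Real.exp_add]
  ring_nf

theorem isBoundedAtImInfty (h : ∀ c ∈ D, c ≠ 0 → 48 ≤ euclWt c) :
    IsBoundedAtImInfty fun τ : ℍ ↦ codeTheta D τ := by
  obtain ⟨K, hK⟩ := norm_sub_one_le h
  have hK0 : 0 ≤ K := by simpa using (norm_nonneg _).trans (hK I (by simp))
  rw [UpperHalfPlane.isBoundedAtImInfty_iff]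
  refine ⟨K + 1, 1, fun τ hτ ↦ ?_⟩
  have h1 : Real.exp (-6 * π * ((τ : ℂ).im - 1)) ≤ 1 := by
    rw [Real.exp_le_one_iff]
    have := mul_nonneg pi_pos.le (sub_nonneg.mpr hτ)
    linarith!
  have h2 := norm_add_le (codeTheta D τ - 1) 1
  rw [sub_add_cancel, norm_one] at h2
  nlinarith [hK τ hτ]

/-- The theta series of a Type II code as a modular form. -/
noncomputable def modularForm (hn : n = 8 * m) (hD : IsSelfDual D) (h16 : ∀ c ∈ D, 16 ∣ euclWt c)
    (h48 : ∀ c ∈ D, c ≠ 0 → 48 ≤ euclWt c) : ModularForm 𝒮ℒ ((4 * m : ℕ) : ℤ) where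
  toFun τ := codeTheta D τ
  slash_action_eq' A hA := by
    obtain ⟨A, rfl⟩ := hA
    exact SlashInvariantForm.slash_action_generators_SL2Z (slash_S hn hD) (slash_T h16 _) A
  holo' := by
    rw [UpperHalfPlane.mdifferentiable_iff]
    refine .congr (fun z hz ↦ (differentiableAt (D := D) hz).differentiableWithinAt) fun z hz ↦ ?_
    simp [ofComplex_apply_of_im_pos hz]
  bdd_at_cusps' hc := by
    rw [Subgroup.IsArithmetic.isCusp_iff_isCusp_SL2Z] at hc
    rw [OnePoint.isBoundedAt_iff_forall_SL2Z hc]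
    intro γ _
    rw [SlashInvariantForm.slash_action_generators_SL2Z (slash_S hn hD) (slash_T h16 _)]
    exact isBoundedAtImInfty h48

end codeTheta

open scoped MatrixGroups in
/-- A Type II code over `ZMod 8` of length `24`, `32` or `40` contains a nonzero codeword of
Euclidean weight less than `48`. -/
theorem IsSelfDual.exists_euclWt_lt {n : ℕ} (hn : n = 24 ∨ n = 32 ∨ n = 40)
    {D : AddSubgroup (Fin n → ZMod 8)} (hD : IsSelfDual D) (h16 : ∀ c ∈ D, 16 ∣ euclWt c) :
    ∃ c ∈ D, c ≠ 0 ∧ euclWt c < 48 := by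
  by_contra! h48
  have := Fintype.ofFinite D
  obtain ⟨i, hi, hni⟩ : ∃ i ≤ 2, n = 8 * (i + 3) := ⟨n / 8 - 3, by omega, by omega⟩
  let f := codeTheta.modularForm hni hD h16 h48
  obtain ⟨K, hK⟩ := codeTheta.norm_sub_one_le_exp_im h48
  have hs := one_mem_strictPeriods_SL
  have hq : UpperHalfPlane.qExpansion 1 (⇑f - 1) = UpperHalfPlane.qExpansion 1 f - 1 := by
    have := ModularForm.qExpansion_sub one_pos hs f (1 : ModularForm 𝒮ℒ 0)
    rwa [ModularForm.qExpansion_one] at this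
  have hcoeff : ∀ j : ℕ, (j : ℝ) < 3 →
      (UpperHalfPlane.qExpansion 1 f).coeff j = (1 : PowerSeries ℂ).coeff j := by
    intro j hj
    rw [← sub_eq_zero, ← map_sub, ← hq]
    refine UpperHalfPlane.qExpansion_coeff_eq_zero_of_norm_le ?_ ?_ ?_ (fun τ hτ ↦ hK τ hτ) hj
    · exact (SlashInvariantFormClass.periodic_comp_ofComplex f hs).sub fun _ ↦ rfl
    · exact f.holo'.sub mdifferentiable_const
    · exact (ModularFormClass.bdd_at_infty f).sub (Filter.const_boundedAtFilter _ 1)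
  refine ModularForm.not_sparse_qExpansion hi f ?_ ?_ ?_
  · simpa using hcoeff 0 (by norm_num)
  · simpa [PowerSeries.coeff_one] using hcoeff 1 (by norm_num)
  · simpa [PowerSeries.coeff_one] using hcoeff 2 (by norm_num)

theorem eq_zero_of_euclWt_eq_zero {n : ℕ} {x : Fin n → ZMod 8} (hx : euclWt x = 0) : x = 0 := by
  have h : ∀ a : ZMod 8, min (a.val ^ 2) ((8 - a.val) ^ 2) = 0 → a = 0 := by decide
  ext i
  rw [h (x i) (Finset.sum_eq_zero_iff.mp hx i (Finset.mem_univ i)), Pi.zero_apply]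

theorem res4_apply {n : ℕ} (v : Fin n → ZMod 8) (i : Fin n) :
    res4 v i = ZMod.castHom (by norm_num : (4 : ℕ) ∣ 8) (ZMod 4) (v i) := rfl

section Doubling

variable {n : ℕ} {w : Fin n → ZMod 8} (hw : ∀ i, w i = 0 ∨ w i = 4)
include hw

theorem add_self_eq_zero_of_zero_or_four : w + w = 0 := by
  ext i
  rcases hw i with h | h <;> rw [Pi.add_apply, Pi.zero_apply, h] <;> decide

theorem innerZ_self_eq_zero : innerZ w w = 0 :=
  Finset.sum_eq_zero fun i _ ↦ by rcases hw i with h | h <;> rw [h] <;> decide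

theorem innerZ_eq_zero_or_four (v : Fin n → ZMod 8) : innerZ w v = 0 ∨ innerZ w v = 4 := by
  have h2 : innerZ w v + innerZ w v = 0 := by
    rw [← innerZ_add_left, add_self_eq_zero_of_zero_or_four hw]
    simp [innerZ]
  revert h2
  generalize innerZ w v = a
  decide +revert

theorem mem_evenPart_sup_closure {C : AddSubgroup (Fin n → ZMod 8)} {x : Fin n → ZMod 8} :
    x ∈ evenPart C w ⊔ AddSubgroup.closure {w} ↔ x ∈ evenPart C w ∨ x + w ∈ evenPart C w := by
  have hww := add_self_eq_zero_of_zero_or_four hw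
  constructor
  · intro hx
    obtain ⟨y, hy, z, hz, rfl⟩ := AddSubgroup.mem_sup.mp hx
    obtain ⟨k, rfl⟩ := AddSubgroup.mem_closure_singleton.mp hz
    rcases Int.even_or_odd' k with ⟨t, rfl | rfl⟩
    · left
      rwa [mul_comm, mul_zsmul, two_zsmul, hww, zsmul_zero, add_zero]
    · right
      rwa [add_zsmul, mul_comm, mul_zsmul, two_zsmul, hww, zsmul_zero, zero_add, one_zsmul,
        add_assoc, hww, add_zero]
  · rintro (hx | hx)
    · exact AddSubgroup.mem_sup_left hx
    · have := AddSubgroup.add_mem_sup hx (AddSubgroup.mem_closure_singleton_self w)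
      rwa [add_assoc, hww, add_zero] at this

theorem IsSelfDual.evenPart_sup_closure {C : AddSubgroup (Fin n → ZMod 8)} (hC : IsSelfDual C)
    (hwC : w ∉ C) : IsSelfDual (evenPart C w ⊔ AddSubgroup.closure {w}) := by
  have hww := innerZ_self_eq_zero hw
  have hw2 := add_self_eq_zero_of_zero_or_four hw
  have horth : ∀ x ∈ evenPart C w, ∀ y ∈ evenPart C w, innerZ x y = 0 :=
    fun x hx y hy ↦ (hC x).mp hx.1 y hy.1
  intro x
  constructor
  · have key : ∀ x ∈ evenPart C w, ∀ y ∈ evenPart C w ⊔ AddSubgroup.closure {w},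
        innerZ x y = 0 := by
      intro x hx y hy
      rcases (mem_evenPart_sup_closure hw).mp hy with hy | hy
      · exact horth x hx y hy
      · have := horth x hx _ hy
        rwa [innerZ_add_right, innerZ_comm x w, hx.2, add_zero] at this
    intro hx y hy
    rcases (mem_evenPart_sup_closure hw).mp hx with hx | hx
    · exact key x hx y hy
    · have hwy : innerZ w y = 0 := by
        rcases (mem_evenPart_sup_closure hw).mp hy with hy | hy
        · exact hy.2
        · have := hy.2
          rwa [innerZ_add_right, hww, add_zero] at this
      have := key _ hx y hy
      rwa [innerZ_add_left, hwy, add_zero] at this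
  · intro hx
    have hwx : innerZ w x = 0 := by
      rw [innerZ_comm]
      exact hx w ((mem_evenPart_sup_closure hw).mpr
        (Or.inr (by rw [hw2]; exact AddSubgroup.zero_mem _)))
    obtain ⟨c, hc, hcw⟩ : ∃ c ∈ C, innerZ w c = 4 := by
      by_contra! h
      exact hwC ((hC w).mpr fun y hy ↦ (innerZ_eq_zero_or_four hw y).resolve_right (h y hy))
    have hx0 : ∀ y ∈ C, innerZ w y = 0 → innerZ x y = 0 := fun y hy hy0 ↦
      hx y (AddSubgroup.mem_sup_left ⟨hy, hy0⟩)
    have hxy : ∀ y ∈ C, innerZ w y = 4 → innerZ x y = - innerZ x c := by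
      intro y hy hy4
      rw [eq_neg_iff_add_eq_zero, ← innerZ_add_right]
      refine hx0 _ (C.add_mem hy hc) ?_
      rw [innerZ_add_right, hy4, hcw]
      decide
    have hxc : innerZ x c = 0 ∨ innerZ x c = 4 := by
      have h := hxy c hc hcw
      revert h
      generalize innerZ x c = a
      decide +revert
    refine (mem_evenPart_sup_closure hw).mpr (hxc.imp (fun h ↦ ⟨?_, hwx⟩) fun h ↦ ⟨?_, ?_⟩)
    · refine (hC x).mpr fun y hy ↦ (innerZ_eq_zero_or_four hw y).elim (hx0 y hy) fun hy4 ↦ ?_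
      rw [hxy y hy hy4, h, neg_zero]
    · refine (hC _).mpr fun y hy ↦ ?_
      rw [innerZ_add_left]
      rcases innerZ_eq_zero_or_four hw y with hy' | hy'
      · rw [hx0 y hy hy', hy', add_zero]
      · rw [hxy y hy hy', hy', h]
        decide
    · rw [innerZ_add_right, hwx, hww, add_zero]

theorem dvd_euclWt_add_iff {v : Fin n → ZMod 8} (hv : 16 ∣ euclWt v) :
    16 ∣ euclWt (v + w) ↔ innerZ w v = 0 := by
  have hmod : euclWt (v + w) ≡ euclWt v + 2 * ∑ i, (w i * v i).val [MOD 16] := by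
    rw [Finset.mul_sum, euclWt, euclWt, ← Finset.sum_add_distrib]
    refine Nat.ModEq.sum fun i _ ↦ ?_
    rw [Pi.add_apply]
    generalize v i = a
    rcases hw i with h | h <;> rw [h] <;> decide +revert
  have hinner : innerZ w v = ((∑ i, (w i * v i).val : ℕ) : ZMod 8) := by
    push_cast
    simp [innerZ]
  rw [hmod.dvd_iff (dvd_refl 16), Nat.dvd_add_right hv, hinner, ZMod.natCast_eq_zero_iff]
  omega

theorem res4_apply_min_le (v : Fin n → ZMod 8) (i : Fin n) :
    min ((res4 v i).val ^ 2) ((4 - (res4 v i).val) ^ 2) ≤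
      min (((v + w) i).val ^ 2) ((8 - ((v + w) i).val) ^ 2) := by
  rw [res4_apply, Pi.add_apply]
  generalize v i = a
  rcases hw i with h | h <;> rw [h] <;> decide +revert

theorem euclWt_res4_le (v : Fin n → ZMod 8) : euclWt (res4 v) ≤ euclWt (v + w) :=
  Finset.sum_le_sum fun i _ ↦ res4_apply_min_le hw v i

theorem euclWt_res4_eq_iff (v : Fin n → ZMod 8) :
    euclWt (res4 v) = euclWt (v + w) ↔
      (∀ j, (v j = 3 ∨ v j = 4 ∨ v j = 5) → w j = 4) ∧
      ∀ j, w j = 4 → (v j = 2 ∨ v j = 3 ∨ v j = 4 ∨ v j = 5 ∨ v j = 6) := by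
  rw [euclWt, euclWt, Finset.sum_eq_sum_iff_of_le fun i _ ↦ res4_apply_min_le hw v i, ← forall_and]
  refine forall_congr' fun i ↦ ?_
  simp only [Finset.mem_univ, true_imp_iff]
  rw [res4_apply, Pi.add_apply]
  generalize v i = a
  rcases hw i with h | h <;> rw [h] <;> decide +revert

theorem euclWt_add_of_euclWt_res4_eq_zero {v : Fin n → ZMod 8} (hv : euclWt (res4 v) = 0) :
    euclWt (v + w) = 16 * ((Finset.univ.filter fun j : Fin n => w j = 4 ∧ v j ≠ 4).card +
      (Finset.univ.filter fun j : Fin n => v j = 4 ∧ w j ≠ 4).card) := by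
  rw [Finset.card_filter, Finset.card_filter, ← Finset.sum_add_distrib, Finset.mul_sum, euclWt]
  refine Finset.sum_congr rfl fun i _ ↦ ?_
  have hi := Finset.sum_eq_zero_iff.mp hv i (Finset.mem_univ i)
  rw [res4_apply] at hi
  rw [Pi.add_apply]
  revert hi
  generalize v i = a
  rcases hw i with h | h <;> rw [h] <;> decide +revert

end Doubling

/-- the doubled code `C̃` is extremal iff no codeword of `C`
satisfies condition (1) or condition (2). -/
theorem doubling_extremal_iff {n : ℕ} (hn : n = 24 ∨ n = 32 ∨ n = 40)
    (kv : Fin 3 → ℕ)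
    (G : Fin (psum kv 3) → Fin n → ZMod 8) (hSF : StandardForm kv G)
    (C : AddSubgroup (Fin n → ZMod 8))
    (hgen : C = AddSubgroup.closure (Set.range G))
    (hsd : IsSelfDual C) (hT2 : ∀ x ∈ C, 16 ∣ euclWt x)
    (hext : minEuclWtIs C 32)
    (hres : minEuclWtIs (C.map res4) 16)
    (w : Fin n → ZMod 8) (hwC : w ∉ C)
    (hcoord : ∀ i, w i = 0 ∨ w i = 4)
    (hS4 : ∀ j : Fin n, w j = 4 → psum kv 3 ≤ (j : ℕ))
    (hcard : 2 ≤ cntEq (4 : ZMod 8) w) :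
    minEuclWtIs (evenPart C w ⊔ AddSubgroup.closure {w}) 32 ↔
      ¬ ∃ v ∈ C,
        ((∀ j : Fin n, (v j = 3 ∨ v j = 4 ∨ v j = 5) → w j = 4) ∧
         (∀ j : Fin n, w j = 4 → (v j = 2 ∨ v j = 3 ∨ v j = 4 ∨ v j = 5 ∨ v j = 6)) ∧
         euclWt (res4 v) = 16) ∨
        ((Finset.univ.filter fun j : Fin n => w j = 4 ∧ v j ≠ 4).card +
         (Finset.univ.filter fun j : Fin n => v j = 4 ∧ w j ≠ 4).card = 1 ∧
         euclWt (res4 v) = 0) := by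
  have hdiv : ∀ v ∈ C, 16 ∣ euclWt (v + w) ↔ innerZ w v = 0 := fun v hv ↦
    dvd_euclWt_add_iff hcoord (hT2 v hv)
  have hne : ∀ v ∈ C, v + w ≠ 0 := fun v hv h ↦ hwC <| by
    rw [← neg_eq_of_add_eq_zero_right h]
    exact C.neg_mem hv
  have hww := add_self_eq_zero_of_zero_or_four hcoord
  have hmem := fun x ↦ mem_evenPart_sup_closure hcoord (C := C) (x := x)
  constructor
  · rintro ⟨hmin, -⟩ ⟨v, hv, hcond⟩
    have h16 : euclWt (v + w) = 16 := by
      rcases hcond with ⟨h1, h2, h3⟩ | ⟨h1, h2⟩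
      · rw [← (euclWt_res4_eq_iff hcoord v).mpr ⟨h1, h2⟩, h3]
      · rw [euclWt_add_of_euclWt_res4_eq_zero hcoord h2, h1]
    have hvw : innerZ w v = 0 := (hdiv v hv).mp (by rw [h16])
    have hle := hmin (v + w) ((hmem _).mpr (Or.inr ?_)) (hne v hv)
    · omega
    · rw [add_assoc, hww, add_zero]
      exact ⟨hv, hvw⟩
  · intro hno
    have hno16 : ∀ v ∈ C, euclWt (v + w) ≠ 16 := by
      intro v hv h16
      refine hno ⟨v, hv, ?_⟩
      by_cases h0 : euclWt (res4 v) = 0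
      · right
        have := euclWt_add_of_euclWt_res4_eq_zero hcoord h0
        exact ⟨by omega, h0⟩
      · left
        have hle := euclWt_res4_le hcoord v
        have hge := hres.1 (res4 v) ⟨v, hv, rfl⟩ fun h ↦ h0 (by rw [h]; simp [euclWt])
        have heq : euclWt (res4 v) = 16 := by omega
        have hcond := (euclWt_res4_eq_iff hcoord v).mp (heq.trans h16.symm)
        exact ⟨hcond.1, hcond.2, heq⟩
    have hcoset : ∀ x, x + w ∈ evenPart C w → x ∉ C ∧ 16 ∣ euclWt x ∧ euclWt x ≠ 16 := by
      intro x hx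
      have hxw : x = x + w + w := by rw [add_assoc, hww, add_zero]
      refine ⟨fun h ↦ hwC ?_, ?_, ?_⟩
      · simpa using C.sub_mem hx.1 h
      · rw [hxw]
        exact (hdiv _ hx.1).mpr hx.2
      · rw [hxw]
        exact hno16 _ hx.1
    have hT2' : ∀ x ∈ evenPart C w ⊔ AddSubgroup.closure {w}, 16 ∣ euclWt x := fun x hx ↦
      ((hmem x).mp hx).elim (fun h ↦ hT2 x h.1) fun h ↦ (hcoset x h).2.1
    have hmin : ∀ x ∈ evenPart C w ⊔ AddSubgroup.closure {w}, x ≠ 0 → 32 ≤ euclWt x := by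
      intro x hx hx0
      rcases (hmem x).mp hx with h | h
      · exact hext.1 x h.1 hx0
      · have h1 := hcoset x h
        have h2 : euclWt x ≠ 0 := fun h ↦ hx0 (eq_zero_of_euclWt_eq_zero h)
        omega
    obtain ⟨c, hc, hc0, hlt⟩ :=
      (hsd.evenPart_sup_closure hcoord hwC).exists_euclWt_lt hn hT2'
    have h1 := hmin c hc hc0
    have h2 := hT2' c hc
    exact ⟨hmin, c, hc, hc0, by omega⟩
end

section
/- There exist ten pairwise inequivalent extremal Type II Z_8-codes of length 32 and type (15,1,1); that is, there exist Z_8-codes C_1, …, C_10 of length 32 such that each C_j is self-dual, every codeword of C_j has Euclidean weight divisible by 16, the minimum Euclidean weight of C_j over nonzero codewords is 32, C_j is isomorphic as an abelian group to (Z/8)^{15} × (Z/4) × (Z/2), and no two of C_1, …, C_10 are equivalent. -/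
open Finset

/-- The Barnes–Wall lattice of rank `32`, scaled so that its minimum is `16`. -/
def bwLattice : AddSubgroup (Fin 32 → ℤ) where
  carrier := {w | (∀ i : Fin 32, 2 ∣ w i + w 0 +
      ∑ k : Fin 5, if i.val / 2 ^ k.val % 2 = 1 then w (Fin.ofNat 32 (2 ^ k.val)) + w 0 else 0) ∧
    4 ∣ ∑ i, w i ∧
    ∀ k : Fin 5, 4 ∣ ∑ i : Fin 32, if i.val / 2 ^ k.val % 2 = 1 then w i else 0}
  zero_mem' := by simp
  add_mem' := by
    rintro a b ⟨ha, ha', ha''⟩ ⟨hb, hb', hb''⟩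
    refine ⟨fun i => ?_, ?_, fun k => ?_⟩
    · refine (dvd_add (ha i) (hb i)).trans (dvd_of_eq ?_)
      rw [add_add_add_comm, ← Finset.sum_add_distrib]
      congr 1
      · simp only [Pi.add_apply]; ring
      · refine Finset.sum_congr rfl fun k _ => ?_
        split_ifs
        · simp only [Pi.add_apply]; ring
        · simp
    · simpa [Finset.sum_add_distrib] using dvd_add ha' hb'
    · refine (dvd_add (ha'' k) (hb'' k)).trans (dvd_of_eq ?_)
      rw [← Finset.sum_add_distrib]
      refine Finset.sum_congr rfl fun i _ => ?_
      split_ifs <;> simp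
  neg_mem' := by
    rintro a ⟨ha, ha', ha''⟩
    refine ⟨fun i => ?_, ?_, fun k => ?_⟩
    · refine (dvd_neg.mpr (ha i)).trans (dvd_of_eq ?_)
      rw [neg_add, ← Finset.sum_neg_distrib]
      congr 1
      · simp only [Pi.neg_apply]; ring
      · refine Finset.sum_congr rfl fun k _ => ?_
        split_ifs
        · simp only [Pi.neg_apply]; ring
        · simp
    · simpa using ha'
    · refine (dvd_neg.mpr (ha'' k)).trans (dvd_of_eq ?_)
      rw [← Finset.sum_neg_distrib]
      refine Finset.sum_congr rfl fun i _ => ?_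
      split_ifs <;> simp

/-- A nonzero affine function on `(ℤ/2)⁵` has at least `16` nonzero values. -/
theorem sixteen_le_card_affine : ∀ (a : ZMod 2) (b : Fin 5 → ZMod 2),
    (∃ i : Fin 32, a + ∑ k : Fin 5, (if i.val / 2 ^ k.val % 2 = 1 then b k else 0) ≠ 0) →
    16 ≤ (univ.filter fun i : Fin 32 =>
      a + ∑ k : Fin 5, (if i.val / 2 ^ k.val % 2 = 1 then b k else 0) ≠ 0).card := by
  decide +kernel

theorem Fin.eq_of_binaryDigits : ∀ i j : Fin 32,
    (∀ k : Fin 5, (i.val / 2 ^ k.val % 2 = 1 ↔ j.val / 2 ^ k.val % 2 = 1)) → i = j := by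
  decide +kernel

theorem card_mul_le_sum_sq {n : ℕ} (w : Fin n → ℤ) (s : Finset (Fin n)) (m : ℤ)
    (h : ∀ i ∈ s, m ≤ w i ^ 2) : s.card * m ≤ ∑ i, w i ^ 2 := by
  calc s.card * m = ∑ _i ∈ s, m := by simp
    _ ≤ ∑ i ∈ s, w i ^ 2 := Finset.sum_le_sum h
    _ ≤ ∑ i, w i ^ 2 :=
      Finset.sum_le_sum_of_subset_of_nonneg (Finset.subset_univ s) fun i _ _ => sq_nonneg _

theorem Int.sq_le_sq_of_dvd {m a : ℤ} (h : m ∣ a) (ha : a ≠ 0) : m ^ 2 ≤ a ^ 2 := by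
  obtain ⟨c, rfl⟩ := h
  have hc : c ≠ 0 := right_ne_zero_of_mul ha
  have : 1 ≤ c ^ 2 := by have := sq_pos_of_ne_zero hc; omega
  nlinarith [sq_nonneg m, mul_pow m c 2]

/-- The sum of the entries `2 t i` modulo `4` counts the odd `t i`. -/
theorem even_card_filter_of_four_dvd {n : ℕ} (t : Fin n → ℤ) (p : Fin n → Prop) [DecidablePred p]
    (h : 4 ∣ ∑ i, if p i then 2 * t i else 0) :
    Even (univ.filter fun i => p i ∧ t i % 2 = 1).card := by
  have h2 : (2 : ℤ) ∣ ∑ i, if p i then t i else 0 := by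
    have : (∑ i, if p i then 2 * t i else 0) = 2 * ∑ i, if p i then t i else 0 := by
      rw [Finset.mul_sum]
      exact Finset.sum_congr rfl fun i _ => by split_ifs <;> simp
    omega
  rw [← ZMod.natCast_eq_zero_iff_even, Finset.card_filter]
  rw [← Nat.cast_two, ← ZMod.intCast_zmod_eq_zero_iff_dvd] at h2
  rw [← h2]
  push_cast
  refine Finset.sum_congr rfl fun i _ => ?_
  by_cases hp : p i
  · rcases Int.emod_two_eq_zero_or_one (t i) with ht | ht
    · have : ((t i : ℤ) : ZMod 2) = 0 := (ZMod.intCast_zmod_eq_zero_iff_dvd _ _).mpr (by omega)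
      simp [hp, ht, this]
    · have : ((t i - 1 : ℤ) : ZMod 2) = 0 := (ZMod.intCast_zmod_eq_zero_iff_dvd _ _).mpr (by omega)
      push_cast at this
      simp [hp, ht, sub_eq_zero.mp this]
  · simp [hp]

/-- The minimum of `bwLattice` is at least `16`. -/
theorem sixteen_le_of_mem_bwLattice {w : Fin 32 → ℤ} (hw : w ∈ bwLattice) (hne : w ≠ 0) :
    16 ≤ ∑ i, w i ^ 2 := by
  obtain ⟨h1, h2, h3⟩ := hw
  by_cases hodd : ∃ i, w i % 2 = 1
  · have key : ∀ i : Fin 32, (((w 0 : ℤ) : ZMod 2) + ∑ k : Fin 5, (if i.val / 2 ^ k.val % 2 = 1 then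
        ((w (Fin.ofNat 32 (2 ^ k.val)) + w 0 : ℤ) : ZMod 2) else 0) ≠ 0) ↔ w i % 2 = 1 := by
      intro i
      have h := (ZMod.intCast_zmod_eq_zero_iff_dvd _ 2).mpr (h1 i)
      push_cast at h
      rw [add_assoc, add_eq_zero_iff_eq_neg, ZMod.neg_eq_self_mod_two] at h
      push_cast
      rw [← h, Ne, ZMod.intCast_zmod_eq_zero_iff_dvd]
      push_cast
      omega
    have hcard := sixteen_le_card_affine ((w 0 : ℤ) : ZMod 2)
      (fun k => ((w (Fin.ofNat 32 (2 ^ k.val)) + w 0 : ℤ) : ZMod 2))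
      (hodd.imp fun i hi => (key i).mpr hi)
    simp only [key] at hcard
    have := card_mul_le_sum_sq w (univ.filter fun i => w i % 2 = 1) 1 fun i hi => by
      have := (Finset.mem_filter.mp hi).2
      have h0 : w i ≠ 0 := by omega
      have := sq_pos_of_ne_zero h0
      omega
    omega
  · push Not at hodd
    have heven : ∀ i, ∃ t, w i = 2 * t := fun i => ⟨w i / 2, by have := hodd i; omega⟩
    choose t ht using heven
    by_cases hodd2 : ∃ i, t i % 2 = 1
    · have hS := even_card_filter_of_four_dvd t (fun _ => True) (by simpa [ht] using h2)
      have hSk := fun k : Fin 5 => even_card_filter_of_four_dvd t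
        (fun i => i.val / 2 ^ k.val % 2 = 1) (by simpa [ht] using h3 k)
      set S := univ.filter fun i => True ∧ t i % 2 = 1 with hSdef
      have hpos : 0 < S.card := by
        obtain ⟨i, hi⟩ := hodd2
        exact Finset.card_pos.mpr ⟨i, by simp [hSdef, hi]⟩
      have h4 : 4 ≤ S.card := by
        by_contra hlt
        have h2 : S.card = 2 := by
          obtain ⟨m, hm⟩ := hS
          omega
        obtain ⟨i, j, hij, hSij⟩ := Finset.card_eq_two.mp h2
        refine hij (Fin.eq_of_binaryDigits i j fun k => ?_)
        have hk := hSk k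
        have hfil : (univ.filter fun i : Fin 32 => i.val / 2 ^ k.val % 2 = 1 ∧ t i % 2 = 1)
            = S.filter fun i => i.val / 2 ^ k.val % 2 = 1 := by
          ext i
          simp [hSdef, and_comm]
        rw [hfil, hSij, Finset.filter_insert, Finset.filter_singleton] at hk
        split_ifs at hk with ha hb hb <;> simp_all
      have := card_mul_le_sum_sq w S 4 fun i hi => by
        have : t i % 2 = 1 := by simpa [hSdef] using hi
        have h0 : w i ≠ 0 := by have := ht i; omega
        exact Int.sq_le_sq_of_dvd (m := 2) ⟨t i, ht i⟩ h0
      omega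
    · push Not at hodd2
      obtain ⟨i, hi⟩ := Function.ne_iff.mp hne
      have := card_mul_le_sum_sq w {i} 16 fun j hj => by
        rw [Finset.mem_singleton.mp hj]
        have h4 : 4 ∣ w i := by have := ht i; have := hodd2 i; omega
        exact Int.sq_le_sq_of_dvd (m := 4) h4 hi
      simpa using this

theorem innerZ_neg_left {N n : ℕ} (x z : Fin n → ZMod N) : innerZ (-x) z = -innerZ x z := by
  simp [innerZ]

/-- The dual code as a subgroup. -/
def dualCode {N n : ℕ} (C : AddSubgroup (Fin n → ZMod N)) : AddSubgroup (Fin n → ZMod N) where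
  carrier := {x | ∀ y ∈ C, innerZ x y = 0}
  zero_mem' := fun y _ => by simp [innerZ]
  add_mem' := fun ha hb y hy => by rw [innerZ_add_left, ha y hy, hb y hy, add_zero]
  neg_mem' := fun ha y hy => by rw [innerZ_neg_left, ha y hy, neg_zero]

theorem innerZ_eq_zero_of_mem_closure {N n : ℕ} {s : Set (Fin n → ZMod N)} {x : Fin n → ZMod N}
    (h : ∀ y ∈ s, innerZ x y = 0) {y : Fin n → ZMod N} (hy : y ∈ AddSubgroup.closure s) :
    innerZ x y = 0 := by
  induction hy using AddSubgroup.closure_induction with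
  | mem y hy => exact h y hy
  | zero => simp [innerZ]
  | add y z _ _ hy hz => rw [innerZ_comm, innerZ_add_left, innerZ_comm y, innerZ_comm z, hy, hz, add_zero]
  | neg y _ hy => rw [innerZ_comm, innerZ_neg_left, innerZ_comm y, hy, neg_zero]

/-- The square of an element of `ℤ/8`, as an element of `ℤ/16`. -/
def liftSq (a : ZMod 8) : ZMod 16 := (a.val ^ 2 : ℕ)

theorem euclWt_cast {n : ℕ} (x : Fin n → ZMod 8) : (euclWt x : ZMod 16) = ∑ i, liftSq (x i) := by
  have h : ∀ a : ZMod 8, ((min (a.val ^ 2) ((8 - a.val) ^ 2) : ℕ) : ZMod 16) = liftSq a := by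
    decide
  simp only [euclWt, ← h, Nat.cast_sum]

theorem euclWt_add_cast {n : ℕ} (x y : Fin n → ZMod 8) (h : innerZ x y = 0) :
    (euclWt (x + y) : ZMod 16) = euclWt x + euclWt y := by
  have key : ∀ a b : ZMod 8,
      liftSq (a + b) = liftSq a + liftSq b + 2 * ((a.val * b.val : ℕ) : ZMod 16) := by decide
  have h8 : 8 ∣ ∑ i, (x i).val * (y i).val := by
    rw [← ZMod.natCast_eq_zero_iff, ← h]
    simp [innerZ]
  have h16 : (2 * ∑ i, (((x i).val * (y i).val : ℕ) : ZMod 16)) = 0 := by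
    rw [← Nat.cast_sum, ← Nat.cast_two, ← Nat.cast_mul, ZMod.natCast_eq_zero_iff]
    omega
  simp only [euclWt_cast, Pi.add_apply, key, Finset.sum_add_distrib, ← Finset.mul_sum, h16,
    add_zero]

theorem sixteen_dvd_euclWt_of_mem_closure {n : ℕ} {s : Set (Fin n → ZMod 8)}
    (horth : ∀ x ∈ AddSubgroup.closure s, ∀ y ∈ AddSubgroup.closure s, innerZ x y = 0)
    (hs : ∀ x ∈ s, 16 ∣ euclWt x) {x : Fin n → ZMod 8} (hx : x ∈ AddSubgroup.closure s) :
    16 ∣ euclWt x := by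
  induction hx using AddSubgroup.closure_induction with
  | mem y hy => exact hs y hy
  | zero => simp [euclWt]
  | add y z hy hz ihy ihz =>
    rw [← ZMod.natCast_eq_zero_iff] at ihy ihz ⊢
    rw [euclWt_add_cast y z (horth y hy z hz), ihy, ihz, add_zero]
  | neg y _ ih =>
    have h : ∀ a : ZMod 8, liftSq (-a) = liftSq a := by decide
    rw [← ZMod.natCast_eq_zero_iff] at ih ⊢
    rw [← ih, euclWt_cast, euclWt_cast]
    simp only [Pi.neg_apply, h]

/-- The integral vector whose entries are the representatives of least absolute value. -/
def minLift {n : ℕ} (x : Fin n → ZMod 8) : Fin n → ℤ := fun i => (x i).valMinAbs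

theorem euclWt_eq_sum_minLift {n : ℕ} (x : Fin n → ZMod 8) :
    (euclWt x : ℤ) = ∑ i, minLift x i ^ 2 := by
  have h : ∀ a : ZMod 8, ((min (a.val ^ 2) ((8 - a.val) ^ 2) : ℕ) : ℤ) = a.valMinAbs ^ 2 := by
    decide
  simp only [euclWt, minLift, ← h, Nat.cast_sum]

/-- Multiplication by `2`, from `ℤ/4` to `ℤ/8`. -/
def mulTwo : ZMod 4 →+ ZMod 8 where
  toFun a := 2 * (a.val : ZMod 8)
  map_zero' := by decide
  map_add' := by decide

/-- Multiplication by `4`, from `ℤ/2` to `ℤ/8`. -/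
def mulFour : ZMod 2 →+ ZMod 8 where
  toFun a := 4 * (a.val : ZMod 8)
  map_zero' := by decide
  map_add' := by decide

/-- Factor by which the `r`-th row of a matrix in standard form of type `(15, 1, 1)` is scaled. -/
def rowScale (r : ℕ) : ℕ := if r < 15 then 1 else if r = 15 then 2 else 4

/-- The generators obtained from the integral matrix `a` by scaling its last two rows. -/
def scaledRow (a : Fin 17 → Fin 32 → ℤ) (r : Fin 17) (c : Fin 32) : ℤ := rowScale r * a r c

/-- The reductions of the generators modulo `8`. -/
def generator (a : Fin 17 → Fin 32 → ℤ) (r : Fin 17) : Fin 32 → ZMod 8 :=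
  fun c => (scaledRow a r c : ℤ)

/-- Encoding by the rows of `a`, the last two scaled by `2` and `4`. -/
def encode (a : Fin 17 → Fin 32 → ℤ) :
    ((Fin 15 → ZMod 8) × ZMod 4 × ZMod 2) →+ (Fin 32 → ZMod 8) where
  toFun x := fun c => ∑ r : Fin 15, x.1 r * (a (Fin.castLE (by norm_num) r) c : ZMod 8) +
    mulTwo x.2.1 * (a 15 c : ZMod 8) + mulFour x.2.2 * (a 16 c : ZMod 8)
  map_zero' := by ext; simp
  map_add' x y := by
    ext
    simp only [Prod.fst_add, Prod.snd_add, Pi.add_apply, map_add, add_mul, Finset.sum_add_distrib]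
    ring

theorem encode_apply (a : Fin 17 → Fin 32 → ℤ) (x : (Fin 15 → ZMod 8) × ZMod 4 × ZMod 2)
    (c : Fin 32) : encode a x c = ∑ r : Fin 15, x.1 r * (a (Fin.castLE (by norm_num) r) c : ZMod 8) +
      mulTwo x.2.1 * (a 15 c : ZMod 8) + mulFour x.2.2 * (a 16 c : ZMod 8) := rfl

/-- The code generated by the rows of `a`, the last two scaled by `2` and `4`. -/
def rowCode (a : Fin 17 → Fin 32 → ℤ) : AddSubgroup (Fin 32 → ZMod 8) := (encode a).range

theorem generator_mem_rowCode (a : Fin 17 → Fin 32 → ℤ) (r : Fin 17) :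
    generator a r ∈ rowCode a := by
  rcases lt_trichotomy r.val 15 with h | h | h
  · refine ⟨(Pi.single ⟨r, h⟩ 1, 0, 0), funext fun c => ?_⟩
    rw [encode_apply, Finset.sum_eq_single ⟨r, h⟩]
    · simp [generator, scaledRow, rowScale, h, Fin.castLE]
    · intro s _ hs
      simp [hs]
    · simp
  · obtain rfl : r = 15 := Fin.ext h
    refine ⟨(0, 1, 0), funext fun c => ?_⟩
    have : mulTwo 1 = 2 := by decide
    simp [encode_apply, generator, scaledRow, rowScale, this]
  · obtain rfl : r = 16 := Fin.ext (by have := r.isLt; simp; omega)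
    refine ⟨(0, 0, 1), funext fun c => ?_⟩
    have : mulFour 1 = 4 := by decide
    simp [encode_apply, generator, scaledRow, rowScale, this]

theorem rowCode_eq_closure (a : Fin 17 → Fin 32 → ℤ) :
    rowCode a = AddSubgroup.closure (Set.range (generator a)) := by
  refine le_antisymm ?_ ((AddSubgroup.closure_le _).mpr ?_)
  · rintro _ ⟨⟨u, s, t⟩, rfl⟩
    have hg := fun r => AddSubgroup.subset_closure (Set.mem_range_self (f := generator a) r)
    have : encode a (u, s, t) =
        ∑ r : Fin 15, (u r).val • generator a (Fin.castLE (by norm_num) r) +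
          s.val • generator a 15 + t.val • generator a 16 := by
      ext c
      simp only [encode_apply, Pi.add_apply, Finset.sum_apply, Pi.smul_apply]
      simp [nsmul_eq_mul, generator, scaledRow, rowScale, mulTwo, mulFour, mul_assoc,
        mul_left_comm]
    rw [this]
    exact add_mem (add_mem (sum_mem fun r _ => nsmul_mem (hg _) _) (nsmul_mem (hg _) _))
      (nsmul_mem (hg _) _)
  · rintro _ ⟨r, rfl⟩
    exact generator_mem_rowCode a r

/-- The matrix `a` starts with an identity block, followed by two more pivots. -/
structure StandardRows (a : Fin 17 → Fin 32 → ℤ) : Prop where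
  left : ∀ (r : Fin 17) (c : Fin 32), c.val < 15 → a r c = if r.val = c.val then 1 else 0
  pivot : a 15 15 = 1
  below : a 16 15 = 0
  corner : a 16 16 = 1

namespace StandardRows

variable {a : Fin 17 → Fin 32 → ℤ}

theorem encode_injective (h : StandardRows a) : Function.Injective (encode a) := by
  rw [injective_iff_map_eq_zero]
  rintro ⟨u, s, t⟩ hx
  have hc := fun c => congrFun hx c
  simp only [encode_apply, Pi.zero_apply] at hc
  have hu : u = 0 := by
    funext r
    have := hc ⟨r, by omega⟩
    have h15 : a 15 ⟨r, by omega⟩ = 0 := by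
      rw [h.left _ _ r.isLt, if_neg (by have := r.isLt; simp; omega)]
    have h16 : a 16 ⟨r, by omega⟩ = 0 := by
      rw [h.left _ _ r.isLt, if_neg (by have := r.isLt; simp; omega)]
    rw [Finset.sum_eq_single r, h15, h16, h.left _ _ r.isLt] at this
    · simpa using this
    · intro s _ hs
      rw [h.left _ _ r.isLt, if_neg (by simpa [Fin.ext_iff] using hs)]
      simp
    · simp
  have hs : s = 0 := by
    have := hc 15
    rw [hu, h.pivot, h.below] at this
    have key : ∀ s, mulTwo s = 0 → s = 0 := by decide
    exact key s (by simpa using this)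
  have ht : t = 0 := by
    have := hc 16
    rw [hu, hs, h.corner] at this
    have key : ∀ t, mulFour t = 0 → t = 0 := by decide
    exact key t (by simpa using this)
  rw [hu, hs, ht]
  rfl

/-- A vector orthogonal to all generators is determined by its last `15` entries, by its `16`-th
entry modulo `4`, and by its `15`-th entry modulo `2`, up to bounded ambiguity. -/
theorem dualCode_ext (h : StandardRows a) {d : Fin 32 → ZMod 8} (hd : d ∈ dualCode (rowCode a))
    (hlast : ∀ c : Fin 32, 17 ≤ c.val → d c = 0) :
    4 * d 16 = 0 ∧ (d 16 = 0 → 2 * d 15 = 0) ∧ (d 16 = 0 → d 15 = 0 → d = 0) := by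
  have horth := fun r => hd _ (generator_mem_rowCode a r)
  have hzero : ∀ c : Fin 32, 15 ≤ c.val → c ≠ 15 → c ≠ 16 → d c = 0 := fun c h1 h2 h3 => by
    refine hlast c ?_
    rw [Ne, Fin.ext_iff] at h2 h3
    simp at h2 h3
    omega
  refine ⟨?_, fun h16 => ?_, fun h16 h15 => ?_⟩
  · have := horth 16
    rw [innerZ, Finset.sum_eq_single 16] at this
    · simpa [generator, scaledRow, rowScale, h.corner, mul_comm] using this
    · intro c _ hc
      by_cases hlt : c.val < 15
      · simp [generator, scaledRow, h.left _ _ hlt, show (16 : ℕ) ≠ c.val by omega]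
      · by_cases h15 : c = 15
        · simp [generator, scaledRow, h15, h.below]
        · simp [hzero c (by omega) h15 hc]
    · simp
  · have := horth 15
    rw [innerZ, Finset.sum_eq_single 15] at this
    · simpa [generator, scaledRow, rowScale, h.pivot, mul_comm] using this
    · intro c _ hc
      by_cases hlt : c.val < 15
      · simp [generator, scaledRow, h.left _ _ hlt, show (15 : ℕ) ≠ c.val by omega]
      · by_cases hc16 : c = 16
        · simp [hc16, h16]
        · simp [hzero c (by omega) hc hc16]
    · simp
  · have hge : ∀ c : Fin 32, 15 ≤ c.val → d c = 0 := fun c hc => by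
      by_cases hc15 : c = 15
      · rw [hc15, h15]
      · by_cases hc16 : c = 16
        · rw [hc16, h16]
        · exact hzero c hc hc15 hc16
    funext c
    by_cases hlt : c.val < 15
    · have := horth ⟨c, by omega⟩
      rw [innerZ, Finset.sum_eq_single c] at this
      · simpa [generator, scaledRow, rowScale, hlt, h.left _ _ hlt] using this
      · intro b _ hb
        by_cases hblt : b.val < 15
        · have : c.val ≠ b.val := fun hcb => hb (Fin.ext hcb.symm)
          simp [generator, scaledRow, h.left _ _ hblt, this]
        · simp [hge b (by omega)]
      · simp
    · exact hge c (by omega)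

theorem card_dualCode_le (h : StandardRows a) :
    Nat.card (dualCode (rowCode a)) ≤ Nat.card (rowCode a) := by
  rw [rowCode, ← Nat.card_congr (AddMonoidHom.ofInjective h.encode_injective).toEquiv]
  refine Nat.card_le_card_of_injective (fun x => (fun r : Fin 15 => x.1 (Fin.natAdd 17 r),
    ((x.1 16).val / 2 : ℕ), ((x.1 15).val / 4 : ℕ))) ?_
  rintro ⟨x, hx⟩ ⟨y, hy⟩ hxy
  simp only [Prod.mk.injEq] at hxy
  obtain ⟨h17, h16, h15⟩ := hxy
  obtain ⟨e16, e15, e⟩ := h.dualCode_ext (sub_mem hx hy) fun c hc => by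
    have := congrFun h17 ⟨c.val - 17, by omega⟩
    have hcc : Fin.natAdd 17 (⟨c.val - 17, by omega⟩ : Fin 15) = c := Fin.ext (by simp; omega)
    rw [hcc] at this
    simp [this]
  have k16 : ∀ u v : ZMod 8, ((u.val / 2 : ℕ) : ZMod 4) = (v.val / 2 : ℕ) → 4 * (u - v) = 0 →
      u - v = 0 := by decide
  have k15 : ∀ u v : ZMod 8, ((u.val / 4 : ℕ) : ZMod 2) = (v.val / 4 : ℕ) → 2 * (u - v) = 0 →
      u - v = 0 := by decide
  have z16 := k16 _ _ h16 e16
  exact Subtype.ext (sub_eq_zero.mp (e z16 (k15 _ _ h15 (e15 z16))))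

theorem isSelfDual (h : StandardRows a)
    (horth : ∀ x ∈ rowCode a, ∀ y ∈ rowCode a, innerZ x y = 0) : IsSelfDual (rowCode a) := by
  have heq : rowCode a = dualCode (rowCode a) :=
    AddSubgroup.eq_of_le_of_card_ge (fun x hx => horth x hx) h.card_dualCode_le
  intro x
  nth_rewrite 1 [heq]
  rfl

end StandardRows

/-- The generators are pairwise orthogonal modulo `8`, and their norms vanish modulo `16`. -/
structure EvenRows (a : Fin 17 → Fin 32 → ℤ) : Prop where
  inner : ∀ r s : Fin 17, s < r → 8 ∣ ∑ c, scaledRow a r c * scaledRow a s c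
  norm : ∀ r : Fin 17, 16 ∣ ∑ c, scaledRow a r c * scaledRow a r c

namespace EvenRows

variable {a : Fin 17 → Fin 32 → ℤ}

theorem innerZ_eq_zero (h : EvenRows a) :
    ∀ x ∈ rowCode a, ∀ y ∈ rowCode a, innerZ x y = 0 := by
  have hsymm : ∀ r s : Fin 17, 8 ∣ ∑ c, scaledRow a r c * scaledRow a s c := fun r s => by
    rcases lt_trichotomy s r with hsr | rfl | hsr
    · exact h.inner r s hsr
    · exact (by norm_num : (8 : ℤ) ∣ 16).trans (h.norm s)
    · simpa only [mul_comm] using h.inner s r hsr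
  intro x hx y hy
  rw [rowCode_eq_closure] at hx hy
  refine innerZ_eq_zero_of_mem_closure ?_ hy
  rintro _ ⟨s, rfl⟩
  rw [innerZ_comm]
  refine innerZ_eq_zero_of_mem_closure ?_ hx
  rintro _ ⟨r, rfl⟩
  have := (ZMod.intCast_zmod_eq_zero_iff_dvd _ 8).mpr (hsymm s r)
  simpa [innerZ, generator] using this

theorem sixteen_dvd_euclWt (h : EvenRows a) : ∀ x ∈ rowCode a, 16 ∣ euclWt x := by
  have horth := h.innerZ_eq_zero
  intro x hx
  rw [rowCode_eq_closure] at horth hx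
  refine sixteen_dvd_euclWt_of_mem_closure horth ?_ hx
  rintro _ ⟨r, rfl⟩
  have key : ∀ m : ℤ, liftSq (m : ZMod 8) = ((m * m : ℤ) : ZMod 16) := fun m => by
    obtain ⟨q, hq⟩ : ∃ q, m = (m : ZMod 8).val + 8 * q := ⟨m / 8, by
      rw [ZMod.val_intCast]; push_cast; omega⟩
    rw [liftSq, ← sub_eq_zero, ← Int.cast_natCast, ← Int.cast_sub,
      ZMod.intCast_zmod_eq_zero_iff_dvd]
    generalize (m : ZMod 8).val = v at hq
    subst hq
    exact ⟨-(q * v) - 4 * q ^ 2, by push_cast; ring⟩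
  have := (ZMod.intCast_zmod_eq_zero_iff_dvd _ 16).mpr (h.norm r)
  rw [← ZMod.natCast_eq_zero_iff, euclWt_cast, ← this]
  simp only [generator, key, Int.cast_sum]

end EvenRows

/-- The rows of `f` are pairwise orthogonal vectors of norm `32` in `bwLattice`, and the integral
combinations of these rows given by the generators lie in eight times this lattice. -/
structure IsFrame (a : Fin 17 → Fin 32 → ℤ) (f : Matrix (Fin 32) (Fin 32) ℤ) : Prop where
  mem : ∀ i, f i ∈ bwLattice
  orth : f * f.transpose = (32 : ℤ) • 1
  glue : ∀ r, ∃ w ∈ bwLattice, Matrix.vecMul (scaledRow a r) f = (8 : ℤ) • w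

namespace IsFrame

variable {a : Fin 17 → Fin 32 → ℤ} {f : Matrix (Fin 32) (Fin 32) ℤ}

/-- Coefficients of eight times a lattice vector in terms of the frame. -/
def coeffs (f : Matrix (Fin 32) (Fin 32) ℤ) : AddSubgroup (Fin 32 → ℤ) where
  carrier := {x | ∃ w ∈ bwLattice, Matrix.vecMul x f = (8 : ℤ) • w}
  zero_mem' := ⟨0, zero_mem _, by simp⟩
  add_mem' := by
    rintro x y ⟨v, hv, hx⟩ ⟨w, hw, hy⟩
    exact ⟨v + w, add_mem hv hw, by rw [Matrix.add_vecMul, hx, hy, smul_add]⟩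
  neg_mem' := by
    rintro x ⟨v, hv, hx⟩
    exact ⟨-v, neg_mem hv, by rw [Matrix.neg_vecMul, hx, smul_neg]⟩

theorem minLift_mem_coeffs (h : IsFrame a f) {x : Fin 32 → ZMod 8} (hx : x ∈ rowCode a) :
    minLift x ∈ coeffs f := by
  have hex : ∃ y ∈ coeffs f, ∀ c, (y c : ZMod 8) = x c := by
    rw [rowCode_eq_closure] at hx
    induction hx using AddSubgroup.closure_induction with
    | mem x hx =>
      obtain ⟨r, rfl⟩ := hx
      exact ⟨scaledRow a r, h.glue r, fun _ => rfl⟩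
    | zero => exact ⟨0, zero_mem _, by simp⟩
    | add x y _ _ hx hy =>
      obtain ⟨x', hx', hxc⟩ := hx
      obtain ⟨y', hy', hyc⟩ := hy
      exact ⟨x' + y', add_mem hx' hy', by simp [hxc, hyc]⟩
    | neg x _ hx =>
      obtain ⟨x', hx', hxc⟩ := hx
      exact ⟨-x', neg_mem hx', by simp [hxc]⟩
  obtain ⟨y, hy, hyx⟩ := hex
  have hdvd : ∀ c, ∃ z, minLift x c - y c = 8 * z := fun c => by
    have : ((minLift x c - y c : ℤ) : ZMod 8) = 0 := by simp [minLift, hyx]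
    exact (ZMod.intCast_zmod_eq_zero_iff_dvd _ 8).mp this
  choose z hz using hdvd
  have hxy : minLift x = (8 : ℤ) • z + y := funext fun c => by
    simp only [Pi.add_apply, Pi.smul_apply, smul_eq_mul, ← hz]
    ring
  rw [hxy]
  refine add_mem ⟨Matrix.vecMul z f, ?_, Matrix.smul_vecMul _ _ _⟩ hy
  rw [Matrix.vecMul_eq_sum]
  exact sum_mem fun i _ => zsmul_mem (h.mem i) _

theorem dotProduct_vecMul (h : IsFrame a f) (x : Fin 32 → ℤ) :
    Matrix.vecMul x f ⬝ᵥ Matrix.vecMul x f = 32 * (x ⬝ᵥ x) := by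
  rw [← Matrix.mulVec_transpose f x, Matrix.dotProduct_mulVec, Matrix.mulVec_transpose,
    Matrix.vecMul_vecMul, h.orth, Matrix.vecMul_smul, Matrix.vecMul_one, smul_dotProduct,
    smul_eq_mul]

theorem thirty_two_le_euclWt (h : IsFrame a f) {x : Fin 32 → ZMod 8} (hx : x ∈ rowCode a)
    (hne : x ≠ 0) : 32 ≤ euclWt x := by
  obtain ⟨w, hw, hxw⟩ := h.minLift_mem_coeffs hx
  have hnorm := h.dotProduct_vecMul (minLift x)
  rw [hxw, smul_dotProduct, dotProduct_smul] at hnorm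
  have hsq : minLift x ⬝ᵥ minLift x = euclWt x := by
    rw [euclWt_eq_sum_minLift]
    exact Finset.sum_congr rfl fun _ _ => (sq _).symm
  have hw2 : w ⬝ᵥ w = ∑ i, w i ^ 2 := Finset.sum_congr rfl fun _ _ => (sq _).symm
  have hpos : 0 < minLift x ⬝ᵥ minLift x := by
    have hl : minLift x ≠ 0 := fun h0 => hne <| funext fun c => by
      simpa [minLift] using congrFun h0 c
    exact lt_of_le_of_ne (Finset.sum_nonneg fun i _ => mul_self_nonneg _)
      (Ne.symm (fun h0 => hl (dotProduct_self_eq_zero.mp h0)))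
  simp only [smul_eq_mul] at hnorm
  have hw0 : w ≠ 0 := fun h0 => by
    rw [h0, zero_dotProduct] at hnorm
    omega
  have := sixteen_le_of_mem_bwLattice hw hw0
  omega

end IsFrame

/-- The vector with entries `4` at two positions. -/
def pairVec (p : Fin 32 × Fin 32) : Fin 32 → ZMod 8 := fun c => if c = p.1 ∨ c = p.2 then 4 else 0

/-- The pairs of positions that support a codeword with two entries equal to `4`. -/
def codePairs (C : AddSubgroup (Fin 32 → ZMod 8)) : Set (Fin 32 × Fin 32) :=
  {p | p.1 ≠ p.2 ∧ pairVec p ∈ C}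

theorem euclWt_pairVec {p : Fin 32 × Fin 32} (hp : p.1 ≠ p.2) : euclWt (pairVec p) = 32 := by
  have hv : (4 : ZMod 8).val = 4 := rfl
  have hfil : (univ.filter fun c => c = p.1 ∨ c = p.2) = {p.1, p.2} := by
    ext c
    simp
  calc euclWt (pairVec p) = ∑ c, if c = p.1 ∨ c = p.2 then 16 else 0 := by
        refine Finset.sum_congr rfl fun c _ => ?_
        rw [pairVec]
        split_ifs <;> simp [hv]
    _ = 32 := by
        rw [← Finset.sum_filter, hfil, Finset.sum_pair hp]

theorem innerZ_pairVec {p : Fin 32 × Fin 32} (hp : p.1 ≠ p.2) (y : Fin 32 → ZMod 8) :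
    innerZ (pairVec p) y = 4 * (y p.1 + y p.2) := by
  have hfil : (univ.filter fun c => c = p.1 ∨ c = p.2) = {p.1, p.2} := by
    ext c
    simp
  simp only [innerZ, pairVec, ite_mul, zero_mul]
  rw [← Finset.sum_filter, hfil, Finset.sum_pair hp, mul_add]

theorem codeEquiv.pairVec_mem_iff {C C' : AddSubgroup (Fin 32 → ZMod 8)}
    {σ : Equiv.Perm (Fin 32)} {ε : Fin 32 → ZMod 8} (hε : ∀ i, ε i = 1 ∨ ε i = -1)
    (h : ∀ y, y ∈ C' ↔ ∃ x ∈ C, y = fun i => ε i * x (σ i)) (p : Fin 32 × Fin 32) :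
    pairVec p ∈ C' ↔ pairVec (σ p.1, σ p.2) ∈ C := by
  have h4 : ∀ i, ε i * 4 = 4 := fun i => by
    rcases hε i with hi | hi <;> rw [hi] <;> decide
  have hsq : ∀ i, ε i * ε i = 1 := fun i => by
    rcases hε i with hi | hi <;> simp [hi]
  have hσ : (pairVec p) = fun i => ε i * pairVec (σ p.1, σ p.2) (σ i) := by
    funext i
    simp [pairVec, h4]
  constructor
  · intro hp
    obtain ⟨x, hx, hpx⟩ := (h _).mp hp
    have : pairVec (σ p.1, σ p.2) = x := by
      funext c
      obtain ⟨i, rfl⟩ := σ.surjective c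
      have hi := congrFun (hσ.symm.trans hpx) i
      have := congrArg (ε i * ·) hi
      simpa [← mul_assoc, hsq] using this
    rwa [this]
  · intro hp
    exact (h _).mpr ⟨_, hp, hσ⟩

theorem codeEquiv.ncard_codePairs_eq {C C' : AddSubgroup (Fin 32 → ZMod 8)}
    (h : codeEquiv C C') : (codePairs C').ncard = (codePairs C).ncard := by
  obtain ⟨σ, ε, hε, h⟩ := h
  rw [← Set.ncard_image_of_injective (codePairs C') (σ.prodCongr σ).injective]
  congr 1
  ext q
  obtain ⟨p, rfl⟩ := (σ.prodCongr σ).surjective q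
  rw [(σ.prodCongr σ).injective.mem_set_image]
  simp [codePairs, codeEquiv.pairVec_mem_iff hε h p]
  exact fun _ => Iff.rfl

theorem mem_codePairs_rowCode {a : Fin 17 → Fin 32 → ℤ} (h : IsSelfDual (rowCode a))
    (p : Fin 32 × Fin 32) :
    p ∈ codePairs (rowCode a) ↔
      p.1 ≠ p.2 ∧ ∀ r : Fin 17, r.val < 15 → (a r p.1 + a r p.2) % 2 = 0 := by
  refine and_congr_right fun hp => ?_
  have hgen : ∀ r, innerZ (pairVec p) (generator a r) = 0 ↔
      2 ∣ rowScale r * (a r p.1 + a r p.2) := fun r => by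
    have : innerZ (pairVec p) (generator a r) =
        ((4 * (rowScale r * (a r p.1 + a r p.2)) : ℤ) : ZMod 8) := by
      rw [innerZ_pairVec hp]
      simp [generator, scaledRow, mul_add]
    rw [this, ZMod.intCast_zmod_eq_zero_iff_dvd]
    push_cast
    omega
  constructor
  · intro hmem r hr
    have := (hgen r).mp ((h _).mp hmem _ (generator_mem_rowCode a r))
    rw [rowScale, if_pos hr] at this
    omega
  · intro hall
    refine (h _).mpr fun y hy => ?_
    rw [rowCode_eq_closure] at hy
    refine innerZ_eq_zero_of_mem_closure ?_ hy
    rintro _ ⟨r, rfl⟩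
    rw [hgen]
    by_cases hr : r.val < 15
    · have := hall r hr
      simp only [rowScale, if_pos hr]
      omega
    · refine Dvd.dvd.mul_right ?_ _
      rw [rowScale, if_neg hr]
      split_ifs <;> norm_num

/-- Sum of the first `n` values of `f`, in a form that the kernel evaluates quickly. -/
def sumTo (n : ℕ) (f : ℕ → ℤ) : ℤ := Nat.rec 0 (fun k s => s + f k) n

/-- A code and a frame of the lattice `bwLattice`, both given row by row; each row is a number
whose `32` decimal digits are the entries, shifted by `4` in the case of `frame`. -/
structure FrameData where
  /-- Rows of a generator matrix, before scaling the last two rows by `2` and `4`. -/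
  gens : List ℕ
  /-- Pairwise orthogonal vectors of squared length `32`. -/
  frame : List ℕ

namespace FrameData

/-- The `c`-th of `32` decimal digits. -/
def digit (a c : ℕ) : ℕ := a / 10 ^ (31 - c) % 10

/-- Entries of the unscaled generators. -/
def row (d : FrameData) (r c : ℕ) : ℕ := digit (d.gens.getD r 0) c

/-- Entries of the generators. -/
def gen (d : FrameData) (r c : ℕ) : ℤ := (rowScale r * d.row r c : ℕ)

/-- Entries of the frame vectors. -/
def vec (d : FrameData) (i c : ℕ) : ℤ := Int.subNatNat (digit (d.frame.getD i 0) c) 4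

/-- Boolean test for membership in `bwLattice`. -/
def latticeTest (w : ℕ → ℤ) : Bool :=
  ((List.range 32).all fun i =>
    (w i + w 0 + sumTo 5 fun k => if i / 2 ^ k % 2 = 1 then w (2 ^ k % 32) + w 0 else 0) % 2 == 0) &&
  sumTo 32 w % 4 == 0 &&
  (List.range 5).all fun k => sumTo 32 (fun i => if i / 2 ^ k % 2 = 1 then w i else 0) % 4 == 0

/-- The generators are in standard form. -/
def shapeTest (d : FrameData) : Bool :=
  ((List.range 17).all fun r => (List.range 15).all fun c =>
    d.row r c == if r = c then 1 else 0) &&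
  d.row 15 15 == 1 && d.row 16 15 == 0 && d.row 16 16 == 1

/-- The generators are pairwise orthogonal modulo `8`, and their norms vanish modulo `16`. -/
def innerTest (d : FrameData) : Bool :=
  (List.range 17).all fun r =>
    sumTo 32 (fun c => d.gen r c * d.gen r c) % 16 == 0 &&
    (List.range r).all fun s => sumTo 32 (fun c => d.gen r c * d.gen s c) % 8 == 0

/-- The frame vectors are pairwise orthogonal of norm `32`. -/
def orthTest (d : FrameData) : Bool :=
  (List.range 32).all fun i =>
    sumTo 32 (fun c => d.vec i c * d.vec i c) == 32 &&
    (List.range i).all fun j => sumTo 32 (fun c => d.vec i c * d.vec j c) == 0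

/-- The frame vectors lie in the lattice. -/
def frameTest (d : FrameData) : Bool := (List.range 32).all fun i => latticeTest (d.vec i)

/-- The combination of frame vectors given by the `r`-th generator. -/
def comb (d : FrameData) (r j : ℕ) : ℤ := sumTo 32 fun i => d.gen r i * d.vec i j

/-- The combinations of frame vectors given by the generators lie in eight times the lattice. -/
def glueTest (d : FrameData) : Bool :=
  (List.range 17).all fun r =>
    ((List.range 32).all fun j => d.comb r j % 8 == 0) && latticeTest fun j => d.comb r j / 8

/-- Columns `i` and `j` of the generator matrix agree modulo `2`. -/
def sameColumn (d : FrameData) (i j : ℕ) : Bool :=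
  (List.range 15).all fun r => (d.row r i + d.row r j) % 2 == 0

/-- Number of ordered pairs of distinct columns that agree modulo `2`. -/
def pairCount (d : FrameData) : ℤ :=
  sumTo 32 fun i => sumTo 32 fun j => if i ≠ j ∧ d.sameColumn i j then 1 else 0

/-- All tests together. -/
def valid (d : FrameData) : Bool :=
  d.shapeTest && d.innerTest && d.orthTest && d.frameTest && d.glueTest

/-- The matrix of unscaled generators. -/
def rows (d : FrameData) : Fin 17 → Fin 32 → ℤ := fun r c => d.row r c

/-- The matrix of frame vectors. -/
def frameMatrix (d : FrameData) : Matrix (Fin 32) (Fin 32) ℤ := Matrix.of fun i c => d.vec i c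

theorem scaledRow_rows (d : FrameData) (r : Fin 17) (c : Fin 32) :
    scaledRow d.rows r c = d.gen r c := by
  simp [scaledRow, rows, gen]

theorem sumTo_eq (n : ℕ) (f : ℕ → ℤ) : sumTo n f = ∑ i : Fin n, f i := by
  rw [Fin.sum_univ_eq_sum_range]
  induction n with
  | zero => rfl
  | succ n ih => rw [Finset.sum_range_succ, ← ih]; rfl

theorem mem_bwLattice_of_latticeTest {w : ℕ → ℤ} (h : latticeTest w = true) :
    (fun i : Fin 32 => w i) ∈ bwLattice := by
  simp only [latticeTest, Bool.and_eq_true, List.all_eq_true, List.mem_range, beq_iff_eq,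
    sumTo_eq] at h
  obtain ⟨⟨h1, h2⟩, h3⟩ := h
  exact ⟨fun i => Int.dvd_of_emod_eq_zero (h1 i i.isLt), Int.dvd_of_emod_eq_zero h2,
    fun k => Int.dvd_of_emod_eq_zero (h3 k k.isLt)⟩

theorem standardRows {d : FrameData} (h : d.shapeTest = true) : StandardRows d.rows := by
  simp only [shapeTest, Bool.and_eq_true, List.all_eq_true, List.mem_range, beq_iff_eq] at h
  obtain ⟨⟨⟨h1, h2⟩, h3⟩, h4⟩ := h
  refine ⟨fun r c hc => ?_, by simp [rows, h2], by simp [rows, h3], by simp [rows, h4]⟩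
  rw [rows, h1 r r.isLt c hc]
  split_ifs <;> rfl

theorem evenRows {d : FrameData} (h : d.innerTest = true) : EvenRows d.rows := by
  simp only [innerTest, Bool.and_eq_true, List.all_eq_true, List.mem_range, beq_iff_eq,
    sumTo_eq] at h
  simp only [← Int.dvd_iff_emod_eq_zero] at h
  refine ⟨fun r s hsr => ?_, fun r => ?_⟩
  · simpa only [scaledRow_rows] using (h r r.isLt).2 s hsr
  · simpa only [scaledRow_rows] using (h r r.isLt).1

theorem isFrame {d : FrameData} (horth : d.orthTest = true) (hframe : d.frameTest = true)
    (hglue : d.glueTest = true) : IsFrame d.rows d.frameMatrix := by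
  simp only [orthTest, Bool.and_eq_true, List.all_eq_true, List.mem_range, beq_iff_eq,
    sumTo_eq] at horth
  simp only [frameTest, List.all_eq_true, List.mem_range] at hframe
  simp only [glueTest, Bool.and_eq_true, List.all_eq_true, List.mem_range, beq_iff_eq,
    ← Int.dvd_iff_emod_eq_zero] at hglue
  refine ⟨fun i => mem_bwLattice_of_latticeTest (hframe i i.isLt), ?_, fun r => ?_⟩
  · ext i j
    rw [Matrix.mul_apply, Matrix.smul_apply, Matrix.one_apply]
    rcases lt_trichotomy j i with hji | rfl | hij
    · simpa [frameMatrix, hji.ne'] using (horth i i.isLt).2 j hji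
    · simpa [frameMatrix] using (horth j j.isLt).1
    · simpa [frameMatrix, hij.ne, mul_comm] using (horth j j.isLt).2 i hij
  · refine ⟨_, mem_bwLattice_of_latticeTest (hglue r r.isLt).2, funext fun j => ?_⟩
    rw [Pi.smul_apply, smul_eq_mul, Int.mul_ediv_cancel' ((hglue r r.isLt).1 j j.isLt)]
    simp [Matrix.vecMul, dotProduct, scaledRow_rows, comb, sumTo_eq, frameMatrix]

theorem ncard_codePairs {d : FrameData} (h : IsSelfDual (rowCode d.rows)) :
    ((codePairs (rowCode d.rows)).ncard : ℤ) = d.pairCount := by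
  have key : ∀ p : Fin 32 × Fin 32, p ∈ codePairs (rowCode d.rows) ↔
      (p.1.val ≠ p.2.val ∧ d.sameColumn p.1 p.2 = true) := fun p => by
    rw [mem_codePairs_rowCode h, Ne, Fin.ext_iff, sameColumn]
    simp only [List.all_eq_true, List.mem_range, beq_iff_eq, rows]
    refine and_congr_right fun _ => ⟨fun hr r hlt => ?_, fun hr r hlt => ?_⟩
    · have := hr ⟨r, by omega⟩ hlt
      simp only at this
      omega
    · have := hr r hlt
      omega
  have hset : codePairs (rowCode d.rows) = ((univ.filter fun p : Fin 32 × Fin 32 =>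
      p.1.val ≠ p.2.val ∧ d.sameColumn p.1 p.2 = true : Finset _) : Set (Fin 32 × Fin 32)) := by
    ext p
    simp [key]
  rw [hset, Set.ncard_coe_finset, Finset.card_filter, pairCount, sumTo_eq, Nat.cast_sum,
    Fintype.sum_prod_type]
  refine Finset.sum_congr rfl fun i _ => ?_
  rw [sumTo_eq]
  exact Finset.sum_congr rfl fun j _ => by split_ifs <;> rfl

end FrameData

/-- The ten frames. The `j`-th code has exactly `j + 1` pairs of equal coordinates modulo `2`. -/
def frameData : List FrameData :=
  [{ gens := [
     10000000000000025443430147151531, 01000000000000026405410751005034,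
     00100000000000044536340424246424, 00010000000000034440642441465044,
     00001000000000053665450627634456, 00000100000000026142523446460420,
     00000010000000024150465206626004, 00000001000000042040444154544606,
     00000000100000014405064440065024, 00000000010000030004424444043030,
     00000000001000004070505620420000, 00000000000100040000206110044106,
     00000000000010047045212255755717, 00000000000001070046676262441060,
     00000000000000126402262736024061, 00000000000000012023030331232232,
     00000000000000001000000000010000]
     frame := [
     44446444466444244464444424446442, 44444444444444448444444448444444,
     22444422444422444444664444444444, 44442624246464444442444444644444,
     48444444444444444444844444444444, 42444446444246444444644244444664,
     62444462444462444444624444444444, 44464446444442644264444424442444,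
     44442464446424442444446446464444, 44444444624444446444446442664442,
     04444464444464444464444464444444, 44224446444642464644444444444464,
     44446444466444644424444464442442, 44444644664444244446444444642446,
     44664444444644424644444244444264, 44444444644444244440444444242444,
     44844444444444484444444444444444, 46444442444242444444244244444664,
     44444464444464444424484424444444, 44446424442464442444446446464444,
     24444444444244444424424624444264, 44444644224444244446444444242442,
     24444444444644444424424224444624, 44466444426444444644444644444646,
     44462444462444444644444644444642, 44446664242424444442444444644444,
     44464446444442244224444464446444, 44444444444444444444440444484444,
     44444044244444244444444444642444, 44264442444646464244444444444464,
     44444444264444446444446442264446, 44264444444244464644444244444224] },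
   { gens := [
     10000000000000050440442746300420, 01000000000000031424444326022202,
     00100000000000044460442647026507, 00010000000000022366444222636276,
     00001000000000005401401722570410, 00000100000000052655320564270634,
     00000010000000032217610364654250, 00000001000000046365000644466212,
     00000000100000006020404425265405, 00000000010000040105004266674464,
     00000000001000056645376762474250, 00000000000100063463406550376636,
     00000000000010022044446204405167, 00000000000001064450354022240460,
     00000000000000104064442603423306, 00000000000000010002001112220200,
     00000000000000001001000100110010]
     frame := [
     44646446446442466444444446444444, 44644444664444462444444442644446,
     44264444444244464664444424444464, 46444424444464244444646444466444,
     44424644464444644642444444446442, 62444444444444444424624224444644,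
     04444442444442444444444244444644, 46444664444424446446644442444444,
     44444444444444444424444664444684, 42442644446444444446246444464444,
     62444442444442444464664464444444, 44424244464444244646444444442442,
     44244444444444464424442264464244, 66444464444464444444264244444644,
     44444444244644444444446244624264, 44442446622442444444444444644442,
     44244444664444426444444446644446, 46442444446444642444644446442444,
     44444462444462444424444624444244, 44442424446464446444442442424444,
     66444422444422444444224444444444, 44444464444464444464404464444444,
     44464644464444244242444444442442, 44442446262442444444444444244446,
     44424644424444244642444444442446, 44664444244444424644442444664444,
     44246446446442422444444442444444, 44446624442464644446444444442444,
     44244444244644464444444644644624, 44424444244044444244444444644444,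
     44444644444444242446442446426444, 44464444444244444624446464424424] },
   { gens := [
     10000000000000045750353362435561, 01000000000000041603070044226446,
     00100000000000024634607131402514, 00010000000000040044304200326001,
     00001000000000025514354500162406, 00000100000000004060140000563240,
     00000010000000026642740244734044, 00000001000000061512770776471101,
     00000000100000057206254644026042, 00000000010000007142750144126746,
     00000000001000063564173031255413, 00000000000100041110710366217177,
     00000000000010045706654646111267, 00000000000001005334114501635701,
     00000000000000161512332466544124, 00000000000000010123232222002202,
     00000000000000001000010000000000]
     frame := [
     64244444244442444424446444444624, 44464444444424442442444664446446,
     26444444664642444444444444464644, 24446262244444444644444446444444,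
     46464444444464644444624444624444, 44444644444444644244444448244444,
     44444446446444264444444626644444, 44244244444444446246442444446446,
     44446424464264424444244644444444, 42444444444464664444464464664444,
     22444444624242444444444444424644, 44244244444444442264446444442464,
     44444444444444444484444444444404, 42644444464644444446446444424446,
     44444444444448444444444444444844, 44442464424664424444244644444444,
     44446424424644446442444444442446, 44464444444444424444684424444444,
     42464444444464244444624444264444, 44464444444424446446444664442442,
     64426464642444444444644644444444, 44446424424644442446444444446442,
     64644444244442444464442444444664, 44464444440444464444244424444444,
     44644244444444446242446444446442, 42244444464644444442442444424442,
     24422424242444444444644644444444, 44444446442444224444444266644444,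
     44444640444444244244444444644444, 42444444444424624444424424664444,
     44244644444444446664446444446464, 64442222644444444644444446444444] },
   { gens := [
     10000000000000006067740440001600, 01000000000000003572374066337111,
     00100000000000026666034201076602, 00010000000000057040444400464140,
     00001000000000062576027260620024, 00000100000000024212021620420663,
     00000010000000043440000010640704, 00000001000000065157710206150575,
     00000000100000002462072225562662, 00000000010000062604046425514260,
     00000000001000023262420140406546, 00000000000100043375460660603705,
     00000000000010062740427220620441, 00000000000001026225464660061072,
     00000000000000125261612606153124, 00000000000000011113230110311223,
     00000000000000001000000000000100]
     frame := [
     44446466444444644644444444464426, 44442644444446644444444444624624,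
     46242444246464444464444444464444, 44444644446644424422444244444244,
     44444244444446446444462444642244, 44444444444442422444422644642444,
     46424444464244444424442464446444, 44442244444442644444444444224224,
     42642444644264444442444444464444, 46642444644624444446444444464444,
     46444444442444444442444420444444, 44444244444444424444044244444644,
     44444644444442446644264644444442, 44244444644442466444424244644444,
     44444444444444844444444444444484, 44444244446644464422444644444644,
     84424444464444444444446444442444, 44444244444444424644646444646442,
     44444408444444444444444444444444, 44644422244444446644424444444446,
     44446422444444644244444444464422, 44444444446204444462444444444444,
     44444444444442426244664444444646, 42444444446444444446444460444444,
     42424444464644444464442424446444, 46646444646464444464444444424444,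
     44484444484444444444444444444444, 44444444446244444426444404444444,
     44644466244444446244424444444442, 04424444464444444444446444442444,
     44644444244442462444464244644444, 44444444444444444244246644646246] },
   { gens := [
     10000000000000077426505407005340, 01000000000000054302200047002404,
     00100000000000047426644724402544, 00010000000000015447543465006140,
     00001000000000063006470446402702, 00000100000000027440264402414302,
     00000010000000012460640025700200, 00000001000000025657166422003574,
     00000000100000045601166010001536, 00000000010000051123604404103544,
     00000000001000060436404416006016, 00000000000100041723200441107500,
     00000000000010022063645022007240, 00000000000001023273726212601360,
     00000000000000167062400442006745, 00000000000000011200132321212203,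
     00000000000000001000000000000100]
     frame := [
     44444464464444444444444666244664, 44444444444844444464424444644644,
     42644444444444404444444444442442, 44444424464466444464464644444424,
     44444424640444446444444444444464, 42444464644444466644444444444422,
     24224444444424444444464442442644, 44444446624444642444644644424444,
     44444442624444242444244644464444, 44644444444226444446444444646644,
     44444644664444642444446244464444, 44644444444644444422464462446444,
     24464464444446444464444442444264, 40444444444444444444444444444448,
     44448242444444444444646444444444, 64464444444624444446464424244444,
     44644642444444464244642444442444, 44444444444426444440444426444444,
     44444642444444444444246444404444, 64424444424446444464444264244444,
     44444444444466444424424422244644, 44444424648444446444444444444464,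
     24464424444424444444424464244424, 42244444444444444044444444446442,
     44444646444444044444646444444444, 64464444444242444462444442444644,
     64264444444446444424444464642444, 46444464644444426244444444444426,
     64424444464424444444424642444244, 44244642444444424644642444446444,
     44444644224444646444446644464444, 44448646444444444444242444444444] },
   { gens := [
     10000000000000042426405204021140, 01000000000000061252663340073670,
     00100000000000007111423224076700, 00010000000000007011403626152340,
     00001000000000046022423642046730, 00000100000000025653125246036504,
     00000010000000003271427036014520, 00000001000000002242654723051316,
     00000000100000035213041000014360, 00000000010000040456436341003354,
     00000000001000061253263604036343, 00000000000100064070200625052664,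
     00000000000010002416056402074600, 00000000000001000440421742066364,
     00000000000000166275607302033270, 00000000000000011121122132123113,
     00000000000000001011001000010100]
     frame := [
     44644442644444642444644444462444, 44444644444444644464466466424444,
     44444424644426446444444426444464, 42444464644444466644444444444422,
     44444244644444222644446444424444, 46448444464444444444444644444442,
     44444444444844444464424444644644, 44844444444444444444444444448444,
     42444444464444444440444644444446, 44444444444422444464464422244644,
     42444444440444424244444444444442, 44444444444426444424464462644644,
     24464464444446444464444442444264, 44644448424444444444444644442444,
     44444644444466244444446444264644, 42444444464444444448444644444446,
     44444244444466644444442444224644, 44444424644462446444444462444464,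
     64424424444446444464444442444224, 44444244444444244464462466464444,
     46440444464444444444444644444442, 24464424444424444444424464244424,
     44444642424444424644242644444444, 44244444424444444444844644446444,
     44444444444044444464424444644644, 84484444444444444444444444444444,
     46444464644444426244444444444426, 24464424444464444444464424644424,
     44644442244444246444644444422444, 44444242424444464244246644444444,
     44444244244444626644446444464444, 42444444448444424244444444444442] },
   { gens := [
     10000000000000042044642122274164, 01000000000000001044520662225020,
     00100000000000027524506260660444, 00010000000000006070646007100000,
     00001000000000000244242552646164, 00000100000000046452603061466644,
     00000010000000042450427026520624, 00000001000000061220740246064421,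
     00000000100000075666562044262666, 00000000010000004260426342444350,
     00000000001000066462005573776456, 00000000000100041007164406222624,
     00000000000010006220405235574750, 00000000000001063422527163346526,
     00000000000000127606130620442626, 00000000000000010323133101303301,
     00000000000000001000100000000000]
     frame := [
     44424246444444646444462444446444, 24442646444644464444444444444646,
     46644444446424444424644446644444, 55553535533335553535355333355333,
     44444444444444444448444844444444, 42444444446424644464246446444444,
     24446646444444444442444644444242, 46244444448444444444444442244444,
     62442444444424444442644642444444, 44244444644644422444444424646444,
     44464246444442444444424444464246, 24442444444264624444646444444444,
     44464246444446444444424444424642, 44644444244644422444444464246444,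
     44444444444444444844444444444484, 66442444444464444442244646444444,
     44464464464442444644464444424424, 46244444442424444464644446244444,
     55333555353533535335335353533353, 64446444444664664444646444444444,
     44424464464446444644424444464424, 44444404484444444444444444444444,
     44464464464446444244464444464464, 44444444444442642444442444462642,
     44444444844444444444444484444444, 35535353553333553333335533335555,
     35355333333535535533355553553535, 44424246444444242444466444442444,
     64446646444244424444444444444646, 44444444444446642444442444422246,
     44244444244244462444444464646444, 42244444444444444404444446244444] },
   { gens := [
     10000000000000024764636446650640, 01000000000000022677264426066267,
     00100000000000045000600504045440, 00010000000000046013440605040446,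
     00001000000000021042621522606640, 00000100000000022124664622234074,
     00000010000000024306670622426674, 00000001000000006272064025006425,
     00000000100000001222040500446120, 00000000010000066064272242274630,
     00000000001000037426044704426244, 00000000000100060463640047020641,
     00000000000010007244406570664024, 00000000000001025206624562162620,
     00000000000000107426702160666004, 00000000000000013200101012303300,
     00000000000000001000000100000000]
     frame := [
     44446442444424644444242444442446, 44444424444444464444444244444024,
     44424244440444444446464444444444, 44444644444442444244464224444624,
     44444424444244624444444646446424, 44444444464424444444444442486444,
     44422444444444444642642424444446, 46444444644440444644444464444444,
     64644444444624442424444444426444, 44464442444464244446442444446446,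
     44444244466244444444464442624444, 42644644244444444664464464444444,
     64244424444444422464444244444464, 46444444224224244444446444444446,
     24466444442444442442644444644444, 44444244426644444444464446664444,
     62446444644444446444646444444446, 44464446424444644646444422444444,
     46444664644446424444464444444244, 46644424644446464464444444444644,
     64462444442444446442244444644444, 44444440444444444644446424444442,
     44444464444244664444444246446464, 66446444244444446444642444444442,
     64244464444444462464444644444424, 44244444444446444624444264444624,
     46444444264664644444446444444446, 44426444424464444442244442446444,
     44424644444444444446424444844444, 64644444444264442424444444462444,
     44446446464444244644244426444444, 44644264444444424464424244444424] },
   { gens := [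
     10000000000000023146620504646460, 01000000000000042620030620614203,
     00100000000000042262400264650031, 00010000000000063646262766403222,
     00001000000000047002030104560373, 00000100000000022621206062542104,
     00000010000000015604446502404004, 00000001000000026266232026432670,
     00000000100000021603252164420733, 00000000010000045250404360200206,
     00000000001000047261010164524017, 00000000000100025022442136604442,
     00000000000010041446420547404662, 00000000000001045060560304002422,
     00000000000000161224627324002026, 00000000000000010132311133201033,
     00000000000000001000000100000000]
     frame := [
     44444844442442444444444444244244, 44446442444424644244244424442444,
     44464442464424444646444464464444, 64644444444444442624444224444424,
     24446444424644442444644446464444, 22444442244444442444444442426444,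
     44244244442442444424464444244644, 44446446444444444444242442466446,
     44444404444444404444444444444444, 64244444424224242464444444444444,
     64446444444624446444644444426444, 44624444446442444466444444244644,
     46444464244444424444446244444466, 44424444442444444646444624644464,
     44444224444442464444424244444264, 44644244442446444464464444244244,
     42444444644244644444446446446446, 44444444446442444444484444644244,
     64244444464664642464444444444444, 46446442644264444444644442444444,
     44464444446444444642444624244464, 44444444464444244244446424466442,
     44444624444446464444464244444664, 42444444644644244444446442442446,
     44664444442442444462444444644644, 42444464644444424444442244444462,
     62444442224464446444444444464444, 44464446424444644446446442444442,
     64644444444444442224444664444464, 46442442624644444444244444446444,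
     44426444444444444642246464444442, 44422444444424644442644442464444] },
   { gens := [
     10000000000000025222220460741220, 01000000000000024200626241400536,
     00100000000000071200226004126464, 00010000000000003242603165114744,
     00001000000000003462442420526647, 00000100000000021604526404364066,
     00000010000000021100466020720466, 00000001000000025423424440146266,
     00000000100000002400005606224110, 00000000010000005276660020340264,
     00000000001000002404444244674114, 00000000000100066600262100664136,
     00000000000010045620207747116474, 00000000000001063446052020120206,
     00000000000000141040204034744404, 00000000000000012131130032101111,
     00000000000000001000000000100000]
     frame := [
     44444266444442444444424444444622, 44242464444644444444444664644464,
     44424426464444444644444444424462, 64444444664244442244444644446444,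
     42444644442442444424424446444244, 46444444444404644444446446444444,
     44424246444442444444464444464246, 24462444444242424444464444424444,
     64442424424444444642444644444424, 44264444462444444664444444264444,
     44644444244644422444444464246444, 44444444644644626444442424446444,
     24444444624444462646444444446444, 24246444446444444422444644244444,
     42444646444424444444644442444646, 44464426424444444244444444464462,
     42444444446464644464646446444444, 44424642444442444444464444464642,
     44664444466444444624444444664444, 64466444444642464444464444424444,
     46444444444444244444842446444444, 64242444446444444426444244244444,
     24442424464644464244444444444424, 44444444244444642446442624442444,
     46444646444464444444244446444646, 44246424444444424446444464644424,
     42444444446424244464242446444444, 44644444644444446446444664242444,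
     44444666444446444444464444444222, 44444444644444642442442264442444,
     44444444244244666444442464446444, 46444644446442444464424442444244] }]

theorem frameData_valid : frameData.all FrameData.valid = true := by decide +kernel

theorem frameData_pairCount :
    ∀ j : Fin 10, (frameData.get j).pairCount = 2 * (j.val + 1) := by decide +kernel

/-- there are ten pairwise inequivalent extremal Type II
`Z₈`-codes of length `32` and type `(15,1,1)`. -/
theorem ten_codes :
    ∃ Cs : Fin 10 → AddSubgroup (Fin 32 → ZMod 8),
      (∀ j, IsSelfDual (Cs j) ∧ (∀ x ∈ Cs j, 16 ∣ euclWt x) ∧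
        minEuclWtIs (Cs j) 32 ∧
        Nonempty ((Cs j) ≃+ ((Fin 15 → ZMod 8) × ZMod 4 × ZMod 2))) ∧
      ∀ j l, j ≠ l → ¬ codeEquiv (Cs j) (Cs l) := by
  have hvalid := fun j : Fin 10 =>
    List.all_eq_true.mp frameData_valid _ (List.get_mem frameData j)
  simp only [FrameData.valid, Bool.and_eq_true] at hvalid
  have hself : ∀ j : Fin 10, IsSelfDual (rowCode (frameData.get j).rows) := fun j =>
    (FrameData.standardRows (hvalid j).1.1.1.1).isSelfDual
      (FrameData.evenRows (hvalid j).1.1.1.2).innerZ_eq_zero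
  have hcount : ∀ j : Fin 10,
      ((codePairs (rowCode (frameData.get j).rows)).ncard : ℤ) = 2 * (j.val + 1) := fun j => by
    rw [FrameData.ncard_codePairs (hself j), frameData_pairCount j]
  refine ⟨fun j => rowCode (frameData.get j).rows, fun j => ?_, fun j l hjl hequiv => hjl ?_⟩
  · obtain ⟨⟨⟨⟨hshape, hinner⟩, horth⟩, hframe⟩, hglue⟩ := hvalid j
    refine ⟨hself j, (FrameData.evenRows hinner).sixteen_dvd_euclWt,
      ⟨fun x hx hne => (FrameData.isFrame horth hframe hglue).thirty_two_le_euclWt hx hne, ?_⟩,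
      ⟨(AddMonoidHom.ofInjective (FrameData.standardRows hshape).encode_injective).symm⟩⟩
    obtain ⟨p, hp, hmem⟩ : (codePairs (rowCode (frameData.get j).rows)).Nonempty := by
      rw [Set.nonempty_iff_ne_empty]
      intro hempty
      have := hcount j
      rw [hempty, Set.ncard_empty] at this
      omega
    refine ⟨pairVec p, hmem, fun h0 => ?_, euclWt_pairVec hp⟩
    have := euclWt_pairVec hp
    simp [h0, euclWt] at this
  · have hj := hcount j
    have hl := hcount l
    have h : (codePairs (rowCode (frameData.get l).rows)).ncard =
        (codePairs (rowCode (frameData.get j).rows)).ncard := hequiv.ncard_codePairs_eq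
    rw [h] at hl
    exact Fin.ext (by omega)
end
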